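/- arXiv:0908.3704 — 8 statements merged into one kernel-verified Lean document; each statement's English description precedes it below -/
import Mathlib

section
/- Let (λ_k)_{k∈ℕ} be a sequence of nonnegative real numbers and s > 0. Then, as an identity in [0, ∞], ∫_ℝ card{k ∈ ℕ : t·λ_k > s} · (π(1+t²))⁻¹ dt = (1/π) ∑_{k∈ℕ} arctan(λ_k / s). (This is the identity ∫_ℝ n₊(s; tT) dμ(t) = (1/π) Tr arctan(s⁻¹T) for a nonnegative trace-class operator T with eigenvalue sequence (λ_k), where dμ(t) = dt/(π(1+t²)).) -/
open MeasureTheory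
open scoped ENNReal

/-- The Cauchy measure `dt / (π (1 + t²))` of the half-line `(a, ∞)`. -/
theorem setLIntegral_Ioi_cauchyDensity (a : ℝ) :
    ∫⁻ t in Set.Ioi a, ENNReal.ofReal (1 / (Real.pi * (1 + t ^ 2))) =
      ENNReal.ofReal (1 / Real.pi) * ENNReal.ofReal (Real.pi / 2 - Real.arctan a) := by
  have hdensity (t : ℝ) : ENNReal.ofReal (1 / (Real.pi * (1 + t ^ 2))) =
      ENNReal.ofReal (1 / Real.pi) * ENNReal.ofReal ((1 + t ^ 2)⁻¹) := by
    rw [← ENNReal.ofReal_mul (by positivity), one_div, one_div, mul_inv]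
  simp_rw [hdensity]
  rw [lintegral_const_mul' _ _ ENNReal.ofReal_ne_top,
    ← ofReal_integral_eq_lintegral_ofReal integrable_inv_one_add_sq.integrableOn
      (.of_forall fun t => by positivity),
    integral_Ioi_inv_one_add_sq]

/-- The Cauchy measure of `{t : s < t x}` is `arctan (x / s) / π`. -/
theorem setLIntegral_lt_mul_cauchyDensity {x s : ℝ} (hx : 0 ≤ x) (hs : 0 < s) :
    ∫⁻ t in {t : ℝ | s < t * x}, ENNReal.ofReal (1 / (Real.pi * (1 + t ^ 2))) =
      ENNReal.ofReal (1 / Real.pi) * ENNReal.ofReal (Real.arctan (x / s)) := by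
  rcases hx.eq_or_lt with rfl | hx
  · simp [hs.not_gt]
  · have hset : {t : ℝ | s < t * x} = Set.Ioi (s / x) := by
      ext t
      simp [div_lt_iff₀ hx]
    rw [hset, setLIntegral_Ioi_cauchyDensity, ← Real.arctan_inv_of_pos (div_pos hs hx), inv_div]

/-- Multiplication by the cardinality of a set as a sum of indicators over the whole type. -/
theorem encard_mul_eq_tsum_indicator {α : Type*} (A : Set α) (c : ℝ≥0∞) :
    (A.encard : ℝ≥0∞) * c = ∑' k, A.indicator (fun _ => c) k := by
  rw [← tsum_subtype, ENNReal.tsum_set_const]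

/-- The identity `∫_ℝ n₊(s; tT) dμ(t) = (1/π) Tr arctan(s⁻¹ T)` for a nonnegative
trace-class operator with eigenvalue sequence `(λ_k)`, where `dμ(t) = dt/(π(1+t²))`,
as an identity in `[0,∞]`. -/
theorem integral_counting_eq_trace_arctan (lam : ℕ → ℝ) (hlam : ∀ k, 0 ≤ lam k)
    (s : ℝ) (hs : 0 < s) :
    ∫⁻ t : ℝ, (({k : ℕ | s < t * lam k}.encard : ℝ≥0∞) *
        ENNReal.ofReal (1 / (Real.pi * (1 + t ^ 2)))) =
      ENNReal.ofReal (1 / Real.pi) * ∑' k : ℕ, ENNReal.ofReal (Real.arctan (lam k / s)) := by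
  have hmeas (k : ℕ) : MeasurableSet {t : ℝ | s < t * lam k} :=
    measurableSet_lt measurable_const (measurable_id.mul_const _)
  calc
    _ = ∫⁻ t : ℝ, ∑' k, {t : ℝ | s < t * lam k}.indicator
          (fun t => ENNReal.ofReal (1 / (Real.pi * (1 + t ^ 2)))) t := by
      refine lintegral_congr fun t => ?_
      rw [encard_mul_eq_tsum_indicator]
      rfl
    _ = ∑' k, ∫⁻ t in {t : ℝ | s < t * lam k},
          ENNReal.ofReal (1 / (Real.pi * (1 + t ^ 2))) := by
      rw [lintegral_tsum fun k => (Measurable.indicator (by fun_prop) (hmeas k)).aemeasurable]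
      exact tsum_congr fun k => lintegral_indicator (hmeas k) _
    _ = _ := by
      simp_rw [setLIntegral_lt_mul_cauchyDensity (hlam _) hs]
      exact ENNReal.tsum_mul_left
end

section
/- Let α > 0, s > 0, and let u₀ : S¹ → [0, ∞] be a measurable function on the unit circle S¹ ⊂ ℝ². Then the Lebesgue measure of the set {x ∈ ℝ² : x ≠ 0 and u₀(x/‖x‖)·‖x‖^{−α} > s} equals s^{−2/α} · (1/2) ∫_{S¹} u₀(θ)^{2/α} dσ(θ), as an identity in [0, ∞]. -/
open MeasureTheory Metric
open scoped ENNReal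

/-- The Euclidean plane. -/
noncomputable abbrev Plane := EuclideanSpace ℝ (Fin 2)

/-- The canonical (arclength) surface measure on the unit circle `S¹ ⊂ ℝ²`,
with total mass `2π`. -/
noncomputable def circleMeasure : Measure (sphere (0 : Plane) 1) :=
  (volume : Measure Plane).toSphere

open Set

theorem volumeIoiPow_univ (n : ℕ) : Measure.volumeIoiPow n univ = ⊤ := by
  refine ENNReal.eq_top_of_forall_nnreal_le fun r ↦ ?_
  have hx : (0 : ℝ) < (n + 1) * r + 1 := by positivity
  refine le_trans ?_ (measure_mono (subset_univ (Iio (⟨(n + 1) * r + 1, hx⟩ : Ioi (0 : ℝ)))))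
  rw [Measure.volumeIoiPow_apply_Iio, ← ENNReal.ofReal_coe_nnreal]
  refine ENNReal.ofReal_le_ofReal ?_
  rw [le_div_iff₀ (by positivity)]
  have h1 : (1 : ℝ) ≤ (n + 1) * r + 1 := le_add_of_nonneg_left (by positivity)
  have h2 := le_self_pow₀ h1 (Nat.succ_ne_zero n)
  simp only [Nat.succ_eq_add_one] at h2
  linarith

/-- The radial part of the superlevel set of a homogeneous function along a fixed direction. -/
theorem volumeIoiPow_one_superlevel {α s : ℝ} (hα : 0 < α) (hs : 0 < s) (c : ℝ≥0∞) :
    Measure.volumeIoiPow 1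
        {r : Ioi (0 : ℝ) | ENNReal.ofReal s < c * ENNReal.ofReal ((r : ℝ) ^ (-α))} =
      ENNReal.ofReal (s ^ (-2 / α)) * ((1 / 2) * c ^ (2 / α)) := by
  have hp : 0 < 2 / α := by positivity
  have hsp : 0 < s ^ (-2 / α) := Real.rpow_pos_of_pos hs _
  have hr (r : Ioi (0 : ℝ)) : 0 < (r : ℝ) ^ (-α) := Real.rpow_pos_of_pos r.2 _
  induction c with
  | top =>
    have h : {r : Ioi (0 : ℝ) | ENNReal.ofReal s < ⊤ * ENNReal.ofReal ((r : ℝ) ^ (-α))} =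
        univ := eq_univ_of_forall fun r ↦ by
      simp [ENNReal.top_mul, hr r]
    rw [h, volumeIoiPow_univ, ENNReal.top_rpow_of_pos hp, ENNReal.mul_top (by simp),
      ENNReal.mul_top (by simpa using hsp)]
  | coe c =>
    rcases eq_or_ne c 0 with rfl | hc
    · simp [ENNReal.zero_rpow_of_pos hp]
    have hc : (0 : ℝ) < c := by positivity
    have hR : ((c : ℝ) / s) ^ (1 / α) ∈ Ioi (0 : ℝ) := mem_Ioi.2 (by positivity)
    have h : {r : Ioi (0 : ℝ) | ENNReal.ofReal s < c * ENNReal.ofReal ((r : ℝ) ^ (-α))} =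
        Iio ⟨((c : ℝ) / s) ^ (1 / α), hR⟩ := by
      ext ⟨r, hr⟩
      have hr : 0 < r := hr
      change ENNReal.ofReal s < c * ENNReal.ofReal (r ^ (-α)) ↔ r < ((c : ℝ) / s) ^ (1 / α)
      rw [← ENNReal.ofReal_coe_nnreal,
        ← ENNReal.ofReal_mul hc.le, ENNReal.ofReal_lt_ofReal_iff (by positivity),
        Real.rpow_neg hr.le, ← div_eq_mul_inv, one_div, Real.lt_rpow_inv_iff_of_pos hr.le
          (by positivity) hα, lt_div_iff₀ (by positivity), lt_div_iff₀ hs, mul_comm]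
    have hsq : (((c : ℝ) / s) ^ (1 / α)) ^ 2 = s ^ (-2 / α) * (c : ℝ) ^ (2 / α) := by
      rw [← Real.rpow_mul_natCast (by positivity), Real.div_rpow hc.le hs.le, neg_div,
        Real.rpow_neg hs.le, div_eq_inv_mul]
      norm_num [div_eq_inv_mul, mul_comm]
    rw [h, Measure.volumeIoiPow_apply_Iio, ← ENNReal.ofReal_coe_nnreal,
      ENNReal.ofReal_rpow_of_pos hc,
      show (1 / 2 : ℝ≥0∞) = ENNReal.ofReal (1 / 2) by
        rw [ENNReal.ofReal_div_of_pos two_pos]; simp,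
      ← ENNReal.ofReal_mul (by norm_num), ← ENNReal.ofReal_mul hsp.le]
    congr 1
    norm_num only [hsq]
    ring

/-- The Lebesgue measure of `{x ∈ ℝ² : u₀(x/‖x‖) ‖x‖^{-α} > s}` equals
`s^{-2/α} (1/2) ∫_{S¹} u₀^{2/α} dσ`, as an identity in `[0,∞]`. -/
theorem measure_superlevel_homogeneous (α s : ℝ) (hα : 0 < α) (hs : 0 < s)
    (u₀ : sphere (0 : Plane) 1 → ℝ≥0∞) (hu₀ : Measurable u₀) :
    volume {x : Plane | x ≠ 0 ∧ ∃ y : sphere (0 : Plane) 1,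
        (y : Plane) = ‖x‖⁻¹ • x ∧
          ENNReal.ofReal s < u₀ y * ENNReal.ofReal (‖x‖ ^ (-α))} =
      ENNReal.ofReal (s ^ (-2 / α)) *
        ((1 / 2) * ∫⁻ θ, u₀ θ ^ (2 / α) ∂circleMeasure) := by
  set T : Set (sphere (0 : Plane) 1 × Ioi (0 : ℝ)) :=
    {p | ENNReal.ofReal s < u₀ p.1 * ENNReal.ofReal ((p.2 : ℝ) ^ (-α))} with hT
  have hTm : MeasurableSet T := measurableSet_lt measurable_const (by fun_prop)
  have hfin : Module.finrank ℝ Plane - 1 = 1 := by simp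
  have himage : {x : Plane | x ≠ 0 ∧ ∃ y : sphere (0 : Plane) 1, (y : Plane) = ‖x‖⁻¹ • x ∧
      ENNReal.ofReal s < u₀ y * ENNReal.ofReal (‖x‖ ^ (-α))} =
      (↑) '' (homeomorphUnitSphereProd Plane ⁻¹' T) := by
    ext x
    constructor
    · rintro ⟨hx, y, hy, h⟩
      refine ⟨⟨x, hx⟩, ?_, rfl⟩
      have : (homeomorphUnitSphereProd Plane ⟨x, hx⟩).1 = y := Subtype.ext <| by simp [hy]
      simpa [hT, this] using h
    · rintro ⟨⟨x, hx⟩, h, rfl⟩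
      exact ⟨hx, (homeomorphUnitSphereProd Plane ⟨x, hx⟩).1, by simp, by simpa [hT] using h⟩
  have hmp := (volume : Measure Plane).measurePreserving_homeomorphUnitSphereProd
  rw [himage, ← comap_subtype_coe_apply (measurableSet_singleton _).compl,
    hmp.measure_preimage hTm.nullMeasurableSet, hfin, Measure.prod_apply hTm, circleMeasure,
    ← lintegral_const_mul _ (by fun_prop), ← lintegral_const_mul _ (by fun_prop)]
  exact lintegral_congr fun θ ↦ volumeIoiPow_one_superlevel hα hs (u₀ θ)
end

section
/- Let α > 0, let u₀ : S¹ → ℝ be continuous and nonnegative, and let U : ℝ² → ℝ be a measurable function such that U(x) = u₀(x/‖x‖)·‖x‖^{−α}·(1 + o(1)) as ‖x‖ → ∞ (i.e. there is a function ε with ε(x) → 0 as ‖x‖ → ∞ and U(x) = u₀(x/‖x‖)‖x‖^{−α}(1 + ε(x)) for all x ≠ 0). Then lim_{s→0⁺} s^{2/α} · |{x ∈ ℝ² : U(x) > s}| = (1/2) ∫_{S¹} u₀(θ)^{2/α} dσ(θ), where |·| denotes Lebesgue measure on ℝ². In particular |{x ∈ ℝ² : U(x) > s}| is finite for all sufficiently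 small s > 0. -/
open MeasureTheory Metric Filter
open scoped ENNReal Topology

/-- Integration in polar coordinates: the Haar measure of a set described by its direction
and its radius. -/
theorem addHaar_image_homeomorphUnitSphereProd_preimage {E : Type*} [NormedAddCommGroup E]
    [NormedSpace ℝ E] [FiniteDimensional ℝ E] [MeasurableSpace E] [BorelSpace E]
    (μ : Measure E) [μ.IsAddHaarMeasure]
    {T : Set (sphere (0 : E) 1 × Set.Ioi (0 : ℝ))} (hT : MeasurableSet T) :
    μ (Subtype.val '' (homeomorphUnitSphereProd E ⁻¹' T)) =
      ∫⁻ θ, Measure.volumeIoiPow (Module.finrank ℝ E - 1) (Prod.mk θ ⁻¹' T) ∂μ.toSphere := by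
  rw [← comap_subtype_coe_apply (measurableSet_singleton (0 : E)).compl μ,
    μ.measurePreserving_homeomorphUnitSphereProd.measure_preimage hT.nullMeasurableSet,
    Measure.prod_apply hT]

theorem mem_image_homeomorphUnitSphereProd_preimage {E : Type*} [NormedAddCommGroup E]
    [NormedSpace ℝ E] {T : Set (sphere (0 : E) 1 × Set.Ioi (0 : ℝ))} {x : E} (hx : x ≠ 0) :
    x ∈ Subtype.val '' (homeomorphUnitSphereProd E ⁻¹' T) ↔
      homeomorphUnitSphereProd E ⟨x, hx⟩ ∈ T := by
  constructor
  · rintro ⟨⟨y, hy⟩, h, rfl⟩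
    exact h
  · exact fun h ↦ ⟨⟨x, hx⟩, h, rfl⟩

theorem volumeIoiPow_setOf_lt (n : ℕ) {a : ℝ} (ha : 0 ≤ a) :
    Measure.volumeIoiPow n {r | r.1 < a} = ENNReal.ofReal (a ^ (n + 1) / (n + 1)) := by
  rcases ha.eq_or_lt with rfl | ha
  · have : {r : Set.Ioi (0 : ℝ) | r.1 < 0} = ∅ := by
      ext r
      simpa using le_of_lt r.2
    simp [this]
  · exact Measure.volumeIoiPow_apply_Iio n ⟨a, ha⟩

theorem volumeIoiPow_setOf_eq (n : ℕ) (a : ℝ) :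
    Measure.volumeIoiPow n {r | r.1 = a} = 0 := by
  refine withDensity_absolutelyContinuous _ _ ?_
  rw [comap_subtype_coe_apply measurableSet_Ioi]
  refine measure_mono_null (t := {a}) ?_ (measure_singleton a)
  rintro _ ⟨r, hr, rfl⟩
  exact hr

/-- The area of a region that is star-shaped about the origin, with radial function `f`. -/
theorem volume_radial_subgraph {f : sphere (0 : Plane) 1 → ℝ} (hf : Measurable f)
    (hf0 : ∀ θ, 0 ≤ f θ) :
    volume (Subtype.val '' (homeomorphUnitSphereProd Plane ⁻¹' {p | p.2.1 < f p.1})) =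
      (1 / 2) * ∫⁻ θ, ENNReal.ofReal (f θ ^ 2) ∂circleMeasure := by
  rw [addHaar_image_homeomorphUnitSphereProd_preimage _
      (measurableSet_lt (by fun_prop) (by fun_prop)),
    ← lintegral_const_mul _ (by fun_prop)]
  refine lintegral_congr fun θ ↦ ?_
  have h := volumeIoiPow_setOf_lt 1 (hf0 θ)
  rw [finrank_euclideanSpace_fin]
  refine h.trans ?_
  rw [show (1 / 2 : ℝ≥0∞) = ENNReal.ofReal (1 / 2) by
      rw [ENNReal.ofReal_div_of_pos two_pos]; simp, ← ENNReal.ofReal_mul (by norm_num)]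
  congr 1
  norm_num
  ring

theorem ae_norm_ne_radial {f : sphere (0 : Plane) 1 → ℝ} (hf : Measurable f) :
    ∀ᵐ x : Plane, x ∉ Subtype.val '' (homeomorphUnitSphereProd Plane ⁻¹' {p | p.2.1 = f p.1}) := by
  rw [← measure_eq_zero_iff_ae_notMem, addHaar_image_homeomorphUnitSphereProd_preimage _
    (measurableSet_eq_fun (by fun_prop) (by fun_prop))]
  exact lintegral_eq_zero_of_ae_eq_zero (ae_of_all _ fun θ ↦ volumeIoiPow_setOf_eq _ (f θ))

/-- Rescaling by `s ^ (1 / α)` turns `s ^ (2 / α)` times an area into an area. -/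
theorem ofReal_rpow_mul_volume_eq {α s : ℝ} (hs : 0 < s) (A : Set Plane) :
    ENNReal.ofReal (s ^ (2 / α)) * volume A =
      volume ((fun y : Plane ↦ s ^ (-(1 / α)) • y) ⁻¹' A) := by
  rw [Measure.addHaar_preimage_smul _ (Real.rpow_pos_of_pos hs _).ne',
    finrank_euclideanSpace_fin, ← Real.rpow_natCast, ← Real.rpow_mul hs.le,
    ← Real.rpow_neg hs.le, abs_of_pos (Real.rpow_pos_of_pos hs _)]
  congr 3
  push_cast
  ring

theorem tendsto_rpow_neg_mul_atTop {α c : ℝ} (hα : 0 < α) (hc : 0 < c) :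
    Tendsto (fun s : ℝ ↦ s ^ (-(1 / α)) * c) (𝓝[>] 0) atTop :=
  (tendsto_rpow_neg_nhdsGT_zero (by simpa using hα)).atTop_mul_const hc

/-- If `U(x) = u₀(x/‖x‖) ‖x‖^{-α} (1 + o(1))` as `‖x‖ → ∞`, then
`s^{2/α} |{U > s}| → (1/2) ∫_{S¹} u₀^{2/α} dσ` as `s ↓ 0`; in particular
`|{U > s}|` is finite for all sufficiently small `s > 0`. -/
theorem measure_superlevel_asymptotics (α : ℝ) (hα : 0 < α)
    (u₀ : sphere (0 : Plane) 1 → ℝ) (hu₀c : Continuous u₀) (hu₀ : ∀ θ, 0 ≤ u₀ θ)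
    (U : Plane → ℝ) (hU : Measurable U)
    (ε : Plane → ℝ) (hε : Tendsto ε (Filter.comap (fun x : Plane => ‖x‖) atTop) (𝓝 0))
    (hUasym : ∀ x : Plane, x ≠ 0 → ∀ y : sphere (0 : Plane) 1,
      (y : Plane) = ‖x‖⁻¹ • x → U x = u₀ y * ‖x‖ ^ (-α) * (1 + ε x)) :
    Tendsto (fun s : ℝ => ENNReal.ofReal (s ^ (2 / α)) * volume {x : Plane | s < U x})
        (𝓝[>] 0)
        (𝓝 ((1 / 2) * ∫⁻ θ, ENNReal.ofReal (u₀ θ ^ (2 / α)) ∂circleMeasure)) ∧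
      ∀ᶠ s : ℝ in 𝓝[>] 0, volume {x : Plane | s < U x} < ⊤ := by
  set d : ∀ x : Plane, x ≠ 0 → sphere (0 : Plane) 1 := fun x hx ↦
    (homeomorphUnitSphereProd Plane ⟨x, hx⟩).1 with hd
  set f : sphere (0 : Plane) 1 → ℝ := fun θ ↦ u₀ θ ^ (1 / α) with hf
  have hfm : Measurable f := (hu₀c.rpow_const fun _ ↦ Or.inr (by positivity)).measurable
  have hf0 : ∀ θ, 0 ≤ f θ := fun θ ↦ Real.rpow_nonneg (hu₀ θ) _
  have hf2 : ∀ θ, f θ ^ 2 = u₀ θ ^ (2 / α) := fun θ ↦ by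
    rw [hf, ← Real.rpow_natCast, ← Real.rpow_mul (hu₀ θ)]
    congr 1
    push_cast
    ring
  have hfα : ∀ θ, f θ ^ α = u₀ θ := fun θ ↦ by
    rw [hf, ← Real.rpow_mul (hu₀ θ), one_div_mul_cancel hα.ne', Real.rpow_one]
  have hscale : ∀ s : ℝ, 0 < s → ∀ (y : Plane) (hy : y ≠ 0), U (s ^ (-(1 / α)) • y) =
      s * (u₀ (d y hy) * ‖y‖ ^ (-α) * (1 + ε (s ^ (-(1 / α)) • y))) := by
    intro s hs y hy
    have hc : 0 < s ^ (-(1 / α)) := Real.rpow_pos_of_pos hs _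
    have hn : ‖s ^ (-(1 / α)) • y‖ = s ^ (-(1 / α)) * ‖y‖ := by
      rw [norm_smul, Real.norm_of_nonneg hc.le]
    rw [hUasym _ (smul_ne_zero hc.ne' hy) (d y hy), hn, Real.mul_rpow hc.le (norm_nonneg _),
      ← Real.rpow_mul hs.le, show -(1 / α) * -α = 1 by field_simp, Real.rpow_one]
    · ring
    · rw [hn, smul_smul, mul_inv_rev, inv_mul_cancel_right₀ hc.ne']
      simp [hd]
  obtain ⟨M, hM⟩ : ∃ M, ∀ θ, u₀ θ ≤ M := by
    obtain ⟨M, hM⟩ := (isCompact_range hu₀c).bddAbove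
    exact ⟨M, fun θ ↦ hM ⟨θ, rfl⟩⟩
  obtain ⟨R, hR⟩ : ∃ R, ∀ x : Plane, R ≤ ‖x‖ → ε x < 1 := by
    have h := hε.eventually (gt_mem_nhds one_pos)
    rw [eventually_comap, eventually_atTop] at h
    obtain ⟨R, hR⟩ := h
    exact ⟨R, fun x hx ↦ hR _ hx x rfl⟩
  -- A radius beyond which the rescaled function never exceeds its level.
  obtain ⟨K, hK1, hKM⟩ : ∃ K : ℝ, 1 ≤ K ∧ ∀ r, K ≤ r → 2 * M ≤ r ^ α := by
    obtain ⟨K, hK⟩ := eventually_atTop.1 ((tendsto_rpow_atTop hα).eventually_ge_atTop (2 * M))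
    exact ⟨max K 1, le_max_right _ _, fun r hr ↦ hK r ((le_max_left _ _).trans hr)⟩
  have hsub : ∀ᶠ s : ℝ in 𝓝[>] 0,
      (fun y : Plane ↦ s ^ (-(1 / α)) • y) ⁻¹' {x | s < U x} ⊆ ball 0 K := by
    filter_upwards [(tendsto_rpow_neg_mul_atTop hα one_pos).eventually_ge_atTop R,
      self_mem_nhdsWithin] with s hsR hs y hy
    have hs : 0 < s := hs
    have hc : 0 < s ^ (-(1 / α)) := Real.rpow_pos_of_pos hs _
    by_contra hyK
    have hyK : K ≤ ‖y‖ := by simpa using hyK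
    have hy0 : 0 < ‖y‖ := by linarith
    have hyne : y ≠ 0 := norm_pos_iff.1 hy0
    have hε1 : ε (s ^ (-(1 / α)) • y) < 1 := by
      refine hR _ (hsR.trans ?_)
      rw [norm_smul, Real.norm_of_nonneg hc.le]
      exact mul_le_mul_of_nonneg_left (hK1.trans hyK) hc.le
    have hlt : s < U (s ^ (-(1 / α)) • y) := hy
    rw [hscale s hs y hyne, lt_mul_iff_one_lt_right hs] at hlt
    have hp : 0 < ‖y‖ ^ α := Real.rpow_pos_of_pos hy0 _
    have hKy := hKM _ hyK
    rw [Real.rpow_neg hy0.le, ← div_eq_mul_inv, div_mul_eq_mul_div, one_lt_div hp] at hlt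
    nlinarith [hu₀ (d y hyne), hM (d y hyne)]
  set T : Set (sphere (0 : Plane) 1 × Set.Ioi (0 : ℝ)) := {p | p.2.1 < f p.1} with hT
  have hTm : MeasurableSet T := measurableSet_lt (by fun_prop) (by fun_prop)
  have hlim : Tendsto (fun s : ℝ ↦ volume ((fun y : Plane ↦ s ^ (-(1 / α)) • y) ⁻¹' {x | s < U x}))
      (𝓝[>] 0) (𝓝 (volume (Subtype.val '' (homeomorphUnitSphereProd Plane ⁻¹' T)))) := by
    refine tendsto_measure_of_ae_tendsto_indicator _
      ((MeasurableEmbedding.subtype_coe (measurableSet_singleton (0 : Plane)).compl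
        ).measurableSet_image.2 ((homeomorphUnitSphereProd Plane).measurable hTm))
      (fun s ↦ (measurable_const_smul (s ^ (-(1 / α)))) (measurableSet_lt measurable_const hU))
      measurableSet_ball measure_ball_lt_top.ne hsub ?_
    filter_upwards [ae_norm_ne_radial hfm, Measure.ae_ne volume (0 : Plane)] with y hyf hy
    rw [mem_image_homeomorphUnitSphereProd_preimage hy] at hyf
    have hy0 : 0 < ‖y‖ := norm_pos_iff.2 hy
    have hp : 0 < ‖y‖ ^ α := Real.rpow_pos_of_pos hy0 _
    have hyf : ‖y‖ ≠ f (d y hy) := by simpa [hd] using hyf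
    have hε0 : Tendsto (fun s : ℝ ↦ ε (s ^ (-(1 / α)) • y)) (𝓝[>] 0) (𝓝 0) := by
      refine hε.comp (tendsto_comap_iff.2 ?_)
      refine (tendsto_rpow_neg_mul_atTop hα hy0).congr' ?_
      filter_upwards [self_mem_nhdsWithin] with s hs
      simp [norm_smul, abs_of_pos (Real.rpow_pos_of_pos (Set.mem_Ioi.1 hs) _)]
    have hg : Tendsto (fun s : ℝ ↦ u₀ (d y hy) * ‖y‖ ^ (-α) * (1 + ε (s ^ (-(1 / α)) • y)))
        (𝓝[>] 0) (𝓝 (u₀ (d y hy) * ‖y‖ ^ (-α))) := by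
      simpa using (hε0.const_add 1).const_mul (u₀ (d y hy) * ‖y‖ ^ (-α))
    have hlt1 : ‖y‖ < f (d y hy) → 1 < u₀ (d y hy) * ‖y‖ ^ (-α) := fun h ↦ by
      rw [Real.rpow_neg hy0.le, ← div_eq_mul_inv, one_lt_div hp, ← hfα]
      exact Real.rpow_lt_rpow hy0.le h hα
    have hgt1 : f (d y hy) < ‖y‖ → u₀ (d y hy) * ‖y‖ ^ (-α) < 1 := fun h ↦ by
      rw [Real.rpow_neg hy0.le, ← div_eq_mul_inv, div_lt_one hp, ← hfα]
      exact Real.rpow_lt_rpow (hf0 _) h hα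
    have hmem : y ∈ Subtype.val '' (homeomorphUnitSphereProd Plane ⁻¹' T) ↔ ‖y‖ < f (d y hy) := by
      rw [mem_image_homeomorphUnitSphereProd_preimage hy]
      simp [hT, hd]
    simp only [hmem, Set.mem_preimage, Set.mem_ofPred_eq]
    rcases hyf.lt_or_gt with h | h
    · filter_upwards [hg.eventually (lt_mem_nhds (hlt1 h)), self_mem_nhdsWithin] with s h1 hs
      rw [hscale s hs y hy, lt_mul_iff_one_lt_right hs]
      exact iff_of_true h1 h
    · filter_upwards [hg.eventually (gt_mem_nhds (hgt1 h)), self_mem_nhdsWithin] with s h1 hs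
      rw [hscale s hs y hy, lt_mul_iff_one_lt_right hs]
      exact iff_of_false h1.not_gt h.not_gt
  refine ⟨?_, ?_⟩
  · rw [volume_radial_subgraph hfm hf0] at hlim
    simp only [hf2] at hlim
    refine hlim.congr' ?_
    filter_upwards [self_mem_nhdsWithin] with s hs
    exact (ofReal_rpow_mul_volume_eq hs _).symm
  · filter_upwards [hsub, self_mem_nhdsWithin] with s hsK hs
    have h := (measure_mono hsK).trans_lt (measure_ball_lt_top (μ := volume))
    rw [← ofReal_rpow_mul_volume_eq hs] at h
    exact ENNReal.lt_top_of_mul_ne_top_right h.ne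
      (ENNReal.ofReal_pos.2 (Real.rpow_pos_of_pos hs _)).ne'
end

section
/- For every real α > 2, the improper integral ∫₀^∞ t · arctan(t^{−α}) dt converges and equals π / (4 cos(π/α)). -/
open MeasureTheory Set

theorem integrableOn_Ioi_and_integral_rpow_sub_one_div_one_add {s : ℝ}
    (hs0 : 0 < s) (hs1 : s < 1) :
    IntegrableOn (fun u : ℝ => u ^ (s - 1) / (1 + u)) (Ioi 0) ∧
      ∫ u in Ioi (0 : ℝ), u ^ (s - 1) / (1 + u) = Real.pi / Real.sin (Real.pi * s) := by
  have inner_fst : ∀ x ∈ Ioi (0 : ℝ), ∫ u in Ioi (0 : ℝ), u ^ (s - 1) * Real.exp (-(x * (1 + u))) =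
      Real.Gamma s * (Real.exp (-x) * x ^ (1 - s - 1)) := by
    intro x (hx : 0 < x)
    have h := Real.integral_rpow_mul_exp_neg_mul_Ioi hs0 hx
    have e : ∀ u : ℝ, u ^ (s - 1) * Real.exp (-(x * (1 + u))) =
        Real.exp (-x) * (u ^ (s - 1) * Real.exp (-(x * u))) := fun u => by
      rw [show -(x * (1 + u)) = -x + -(x * u) by ring, Real.exp_add]; ring
    simp_rw [e]
    rw [integral_const_mul, h, one_div, Real.inv_rpow hx.le, ← Real.rpow_neg hx.le,
      show 1 - s - 1 = -s by ring]
    ring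
  have inner_snd : ∀ u ∈ Ioi (0 : ℝ), ∫ x in Ioi (0 : ℝ), u ^ (s - 1) * Real.exp (-(x * (1 + u))) =
      u ^ (s - 1) / (1 + u) := by
    intro u (hu : 0 < u)
    have h := Real.integral_rpow_mul_exp_neg_mul_Ioi one_pos (show 0 < 1 + u by positivity)
    simp only [sub_self, Real.rpow_zero, one_mul, Real.rpow_one, Real.Gamma_one, mul_one] at h
    simp_rw [mul_comm _ (1 + u)]
    rw [integral_const_mul, h, mul_one_div]
  have gamma_int := (Real.GammaIntegral_convergent (sub_pos.2 hs1)).const_mul (Real.Gamma s)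
  have prod_int : Integrable (Function.uncurry fun x u : ℝ =>
      u ^ (s - 1) * Real.exp (-(x * (1 + u))))
      ((volume.restrict (Ioi 0)).prod (volume.restrict (Ioi 0))) := by
    refine (integrable_prod_iff (by simp only [Function.uncurry_def]; fun_prop)).2 ⟨?_, ?_⟩
    · refine ae_restrict_of_forall_mem measurableSet_Ioi fun x hx => ?_
      refine Integrable.of_integral_ne_zero ?_
      simp only [Function.uncurry_apply_pair]
      rw [inner_fst x hx]
      have := Real.Gamma_pos_of_pos hs0
      have : 0 < x := hx
      positivity
    · refine gamma_int.congr (ae_restrict_of_forall_mem measurableSet_Ioi fun x hx => ?_)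
      dsimp only
      rw [← inner_fst x hx]
      refine setIntegral_congr_fun measurableSet_Ioi fun u (hu : 0 < u) => ?_
      rw [Function.uncurry_apply_pair, Real.norm_of_nonneg (by positivity)]
  constructor
  · exact prod_int.integral_prod_right.congr
      (ae_restrict_of_forall_mem measurableSet_Ioi inner_snd)
  · rw [← setIntegral_congr_fun measurableSet_Ioi inner_snd, ← integral_integral_swap prod_int,
      setIntegral_congr_fun measurableSet_Ioi inner_fst, integral_const_mul,
      ← Real.Gamma_eq_integral (sub_pos.2 hs1), Real.Gamma_mul_Gamma_one_sub]

theorem arctan_le_self_of_nonneg {x : ℝ} (hx : 0 ≤ x) : Real.arctan x ≤ x := by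
  simpa [Real.tan_arctan] using
    Real.le_tan (Real.arctan_nonneg.2 hx) (Real.arctan_lt_pi_div_two x)

theorem mul_arctan_rpow_neg_le {α t : ℝ} (ht : 0 < t) :
    t * Real.arctan (t ^ (-α)) ≤ t ^ (1 - α) := by
  rw [sub_eq_add_neg, Real.rpow_add ht, Real.rpow_one]
  exact mul_le_mul_of_nonneg_left (arctan_le_self_of_nonneg (by positivity)) ht.le

theorem integrableOn_mul_arctan_rpow_neg {α : ℝ} (hα : 2 < α) :
    IntegrableOn (fun t : ℝ => t * Real.arctan (t ^ (-α))) (Ioi 0) := by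
  have meas : Measurable fun t : ℝ => t * Real.arctan (t ^ (-α)) := by fun_prop
  rw [← Ioc_union_Ioi_eq_Ioi zero_le_one]
  refine IntegrableOn.union ?_ ?_
  · refine Measure.integrableOn_of_bounded (M := Real.pi / 2) (by simp)
      meas.aestronglyMeasurable (ae_restrict_of_forall_mem measurableSet_Ioc fun t ht => ?_)
    have ht0 : 0 < t := ht.1
    rw [Real.norm_of_nonneg (by positivity)]
    nlinarith [ht.2, Real.arctan_lt_pi_div_two (t ^ (-α)), Real.pi_pos,
      Real.arctan_nonneg.2 (Real.rpow_nonneg ht0.le (-α))]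
  · refine (integrableOn_Ioi_rpow_of_lt (show 1 - α < -1 by linarith) one_pos).mono'
      meas.aestronglyMeasurable (ae_restrict_of_forall_mem measurableSet_Ioi fun t ht => ?_)
    have ht0 : 0 < t := one_pos.trans ht
    rw [Real.norm_of_nonneg (by positivity)]
    exact mul_arctan_rpow_neg_le ht0

theorem integrableOn_and_integral_rpow_div_one_add_rpow {α : ℝ} (hα : 2 < α) :
    IntegrableOn (fun t : ℝ => t ^ (1 - α) / (1 + t ^ (-2 * α))) (Ioi 0) ∧
      ∫ t in Ioi (0 : ℝ), t ^ (1 - α) / (1 + t ^ (-2 * α)) =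
        Real.pi / (2 * α * Real.cos (Real.pi / α)) := by
  have hα0 : 0 < α := by linarith
  have hinv : 1 / α < 1 / 2 := one_div_lt_one_div_of_lt two_pos hα
  have hinv0 : 0 < 1 / α := by positivity
  set s : ℝ := 1 / 2 - 1 / α with hs
  obtain ⟨hint, hval⟩ := integrableOn_Ioi_and_integral_rpow_sub_one_div_one_add
    (s := s) (by linarith) (by linarith)
  have hp : -2 * α ≠ 0 := by linarith
  have subst_eq : ∀ t ∈ Ioi (0 : ℝ), t ^ (-2 * α - 1) • ((t ^ (-2 * α)) ^ (s - 1) /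
      (1 + t ^ (-2 * α))) = t ^ (1 - α) / (1 + t ^ (-2 * α)) := by
    intro t (ht : 0 < t)
    rw [← Real.rpow_mul ht.le, smul_eq_mul, ← mul_div_assoc, ← Real.rpow_add ht]
    congr 2
    rw [hs]
    field_simp
    ring
  refine ⟨((integrableOn_Ioi_comp_rpow_iff' _ hp).2 hint).congr_fun subst_eq measurableSet_Ioi, ?_⟩
  have h := integral_comp_rpow_Ioi (fun u : ℝ => u ^ (s - 1) / (1 + u)) hp
  simp_rw [mul_smul] at h
  rw [integral_smul, setIntegral_congr_fun measurableSet_Ioi subst_eq, hval,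
    show Real.pi * s = Real.pi / 2 - Real.pi / α by rw [hs]; ring,
    Real.sin_pi_div_two_sub, abs_of_neg (by linarith), smul_eq_mul] at h
  rw [eq_div_of_mul_eq (by linarith) ((mul_comm _ _).trans h), div_div]
  congr 1
  ring

theorem hasDerivAt_arctan_rpow_neg {α t : ℝ} (ht : 0 < t) :
    HasDerivAt (fun t : ℝ => Real.arctan (t ^ (-α)))
      (-α * t ^ (-α - 1) / (1 + t ^ (-2 * α))) t := by
  convert! (Real.hasDerivAt_rpow_const (p := -α) (Or.inl ht.ne')).arctan using 1
  rw [← Real.rpow_natCast, ← Real.rpow_mul ht.le]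
  ring_nf

open Filter Topology in
theorem tendsto_arctan_rpow_neg_mul_sq_nhdsGT_zero (α : ℝ) :
    Tendsto (fun t : ℝ => Real.arctan (t ^ (-α)) * (t ^ 2 / 2)) (𝓝[>] 0) (𝓝 0) := by
  have lim : Tendsto (fun t : ℝ => Real.pi / 2 * (t ^ 2 / 2)) (𝓝[>] 0) (𝓝 0) := by
    have : Continuous fun t : ℝ => Real.pi / 2 * (t ^ 2 / 2) := by fun_prop
    simpa using (this.tendsto 0).mono_left nhdsWithin_le_nhds
  refine squeeze_zero' ?_ ?_ lim
  · filter_upwards [self_mem_nhdsWithin] with t (ht : 0 < t)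
    positivity
  · exact .of_forall fun t => mul_le_mul_of_nonneg_right
      (Real.arctan_lt_pi_div_two _).le (by positivity)

open Filter Topology in
theorem tendsto_arctan_rpow_neg_mul_sq_atTop {α : ℝ} (hα : 2 < α) :
    Tendsto (fun t : ℝ => Real.arctan (t ^ (-α)) * (t ^ 2 / 2)) atTop (𝓝 0) := by
  have lim := (tendsto_rpow_neg_atTop (sub_pos.2 hα)).div_const 2
  rw [zero_div] at lim
  refine squeeze_zero' ?_ ?_ lim
  · filter_upwards [eventually_gt_atTop 0] with t ht
    positivity
  · filter_upwards [eventually_gt_atTop 0] with t ht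
    have h := mul_le_mul_of_nonneg_left (mul_arctan_rpow_neg_le (α := α) ht) ht.le
    rw [show -(α - 2) = 1 + (1 - α) by ring, Real.rpow_add ht, Real.rpow_one]
    linarith

/-- For `α > 2`, the integral `∫₀^∞ t arctan(t^{-α}) dt` converges and equals
`π / (4 cos(π/α))`. -/
theorem integral_mul_arctan_rpow_neg (α : ℝ) (hα : 2 < α) :
    IntegrableOn (fun t : ℝ => t * Real.arctan (t ^ (-α))) (Ioi 0) ∧
      ∫ t in Ioi (0 : ℝ), t * Real.arctan (t ^ (-α)) =
        Real.pi / (4 * Real.cos (Real.pi / α)) := by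
  refine ⟨integrableOn_mul_arctan_rpow_neg hα, ?_⟩
  obtain ⟨kernel_int, kernel_val⟩ := integrableOn_and_integral_rpow_div_one_add_rpow hα
  have deriv_mul_eq : ∀ t ∈ Ioi (0 : ℝ), -α * t ^ (-α - 1) / (1 + t ^ (-2 * α)) * (t ^ 2 / 2) =
      -α / 2 * (t ^ (1 - α) / (1 + t ^ (-2 * α))) := by
    intro t (ht : 0 < t)
    rw [show 1 - α = -α - 1 + (2 : ℕ) by push_cast; ring, Real.rpow_add ht, Real.rpow_natCast]
    ring
  have parts := integral_Ioi_mul_deriv_eq_deriv_mul (a := 0)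
    (u := fun t : ℝ => Real.arctan (t ^ (-α))) (v := fun t : ℝ => t ^ 2 / 2)
    (v' := fun t : ℝ => t)
    (fun t ht => hasDerivAt_arctan_rpow_neg ht)
    (fun t _ => by simpa using (hasDerivAt_pow 2 t).div_const 2)
    ((integrableOn_mul_arctan_rpow_neg hα).congr_fun (fun t _ => mul_comm _ _) measurableSet_Ioi)
    (IntegrableOn.congr_fun (kernel_int.const_mul (-α / 2)) (fun t ht => (deriv_mul_eq t ht).symm)
      measurableSet_Ioi)
    (tendsto_arctan_rpow_neg_mul_sq_nhdsGT_zero α) (tendsto_arctan_rpow_neg_mul_sq_atTop hα)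
  simp_rw [mul_comm _ (Real.arctan _)]
  rw [parts, setIntegral_congr_fun measurableSet_Ioi deriv_mul_eq, integral_const_mul, kernel_val]
  have hα0 : α ≠ 0 := by linarith
  field_simp
  ring
end

section
/- Let μ be a finite Borel measure on ℝ² with μ({0}) = 0, let h : ℝ² → ℂ be measurable with |h(λ)| ≤ 1 for all λ, and assume ∫_{ℝ²} ‖λ‖⁻² dμ(λ) < ∞. Define b̃(x) := ∫_{ℝ²} exp(i⟨λ, x⟩) h(λ) dμ(λ) and φ̃(x) := −∫_{ℝ²} ‖λ‖⁻² exp(i⟨λ, x⟩) h(λ) dμ(λ). Then b̃ is continuous and bounded, φ̃ is twice continuously differentiable, φ̃ together with all its partial derivatives of order up to two is bounded, and Δφ̃(x) = b̃(x) for every x ∈ ℝ², where Δ = ∂²/∂x₁² + ∂²/∂x₂². (This realizes a bounded C² solution of the Poisson equation Δφ̃ = b̃ for a background b̃ given by the Fourier transform of a finite charge ν = h·μ satisfying ν({0}) = 0 and ∫‖λ‖⁻² d|ν| < ∞.) -/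
open MeasureTheory
open scoped RealInnerProductSpace ENNReal

/-- The Laplacian `Δ = ∂²/∂x₁² + ∂²/∂x₂²` of a function on the plane. -/
noncomputable def lap2 (f : Plane → ℂ) (x : Plane) : ℂ :=
  ∑ i : Fin 2, fderiv ℝ (fun y => fderiv ℝ f y (EuclideanSpace.single i (1 : ℝ))) x
    (EuclideanSpace.single i (1 : ℝ))

/-- The background `b̃(x) = ∫_{ℝ²} e^{i⟨λ,x⟩} h(λ) dμ(λ)`. -/
noncomputable def bTilde (μ : Measure Plane) (h : Plane → ℂ) (x : Plane) : ℂ :=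
  ∫ l, Complex.exp (Complex.I * Complex.ofReal ⟪l, x⟫) * h l ∂μ

/-- The potential `φ̃(x) = −∫_{ℝ²} ‖λ‖⁻² e^{i⟨λ,x⟩} h(λ) dμ(λ)`. -/
noncomputable def phiTilde (μ : Measure Plane) (h : Plane → ℂ) (x : Plane) : ℂ :=
  -∫ l, (Complex.ofReal (‖l‖ ^ (-2 : ℝ))) * Complex.exp (Complex.I * Complex.ofReal ⟪l, x⟫) *
    h l ∂μ

section FourierIntegral

variable {V E : Type*} [NormedAddCommGroup V] [InnerProductSpace ℝ V]
  [NormedAddCommGroup E] [NormedSpace ℂ E]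

theorem norm_cexp_I_mul_inner (l x : V) :
    ‖Complex.exp (Complex.I * Complex.ofReal ⟪l, x⟫)‖ = 1 := by
  rw [mul_comm, Complex.norm_exp_ofReal_mul_I]

theorem continuous_cexp_I_mul_inner_left (x : V) :
    Continuous fun l : V => Complex.exp (Complex.I * Complex.ofReal ⟪l, x⟫) := by
  fun_prop

theorem continuous_cexp_I_mul_inner_right (l : V) :
    Continuous fun x : V => Complex.exp (Complex.I * Complex.ofReal ⟪l, x⟫) := by
  fun_prop

section Derivative

variable [NormedSpace ℝ E]

/-- The symbol of the derivative of the Fourier integral with symbol `g`. -/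
noncomputable def derivSymbol (g : V → E) (l : V) : V →L[ℝ] E :=
  (innerSL ℝ l).smulRight (Complex.I • g l)

theorem norm_derivSymbol (g : V → E) (l : V) : ‖derivSymbol g l‖ = ‖l‖ * ‖g l‖ := by
  simp [derivSymbol, ContinuousLinearMap.norm_smulRight_apply, norm_smul]

theorem hasFDerivAt_cexp_I_mul_inner_smul [IsScalarTower ℝ ℂ E] (g : V → E) (l x : V) :
    HasFDerivAt (fun x => Complex.exp (Complex.I * Complex.ofReal ⟪l, x⟫) • g l)
      (Complex.exp (Complex.I * Complex.ofReal ⟪l, x⟫) • derivSymbol g l) x := by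
  have h1 : HasFDerivAt (fun x : V => Complex.ofReal ⟪l, x⟫)
      (Complex.ofRealCLM.comp (innerSL ℝ l)) x :=
    (Complex.ofRealCLM.comp (innerSL ℝ l)).hasFDerivAt
  have h2 := ((h1.const_mul Complex.I).cexp).smul_const (g l)
  convert h2 using 1
  ext v
  simp only [derivSymbol, smul_apply, ContinuousLinearMap.smulRight_apply,
    ContinuousLinearMap.comp_apply, Complex.ofRealCLM_apply, innerSL_apply_apply, smul_eq_mul]
  rw [← algebraMap_smul ℂ (⟪l, v⟫ : ℝ) (Complex.I • g l), smul_smul, smul_smul]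
  congr 1
  simp only [Complex.coe_algebraMap]
  ring

end Derivative

variable [MeasurableSpace V]

section Measurability

variable [BorelSpace V]

theorem aestronglyMeasurable_cexp_smul {μ : Measure V} {g : V → E}
    (hg : AEStronglyMeasurable g μ) (x : V) :
    AEStronglyMeasurable
      (fun l => Complex.exp (Complex.I * Complex.ofReal ⟪l, x⟫) • g l) μ :=
  (continuous_cexp_I_mul_inner_left x).aestronglyMeasurable.smul hg

theorem integrable_cexp_smul {μ : Measure V} {g : V → E} (hg : Integrable g μ) (x : V) :
    Integrable (fun l => Complex.exp (Complex.I * Complex.ofReal ⟪l, x⟫) • g l) μ :=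
  hg.norm.mono' (aestronglyMeasurable_cexp_smul hg.1 x)
    (.of_forall fun l => by rw [norm_smul, norm_cexp_I_mul_inner, one_mul])

end Measurability

variable [NormedSpace ℝ E]

/-- The inverse-Fourier-type integral `x ↦ ∫ e^{i⟨l,x⟩} g(l) dμ(l)`. -/
noncomputable def fourierInt (μ : Measure V) (g : V → E) (x : V) : E :=
  ∫ l, Complex.exp (Complex.I * Complex.ofReal ⟪l, x⟫) • g l ∂μ

theorem norm_fourierInt_le (μ : Measure V) (g : V → E) (x : V) :
    ‖fourierInt μ g x‖ ≤ ∫ l, ‖g l‖ ∂μ := by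
  refine (norm_integral_le_integral_norm _).trans_eq ?_
  simp only [norm_smul, norm_cexp_I_mul_inner, one_mul]

variable [BorelSpace V]

theorem continuous_fourierInt {μ : Measure V} {g : V → E} (hg : Integrable g μ) :
    Continuous (fourierInt μ g) := by
  refine continuous_of_dominated (aestronglyMeasurable_cexp_smul hg.1)
    (fun x => .of_forall fun l => ?_) hg.norm
    (.of_forall fun l => (continuous_cexp_I_mul_inner_right l).smul continuous_const)
  rw [norm_smul, norm_cexp_I_mul_inner, one_mul]

variable [SecondCountableTopology V]

theorem aestronglyMeasurable_derivSymbol {μ : Measure V} {g : V → E}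
    (hg : AEStronglyMeasurable g μ) : AEStronglyMeasurable (derivSymbol g) μ := by
  have h1 : Continuous fun p : (V →L[ℝ] ℝ) × E => p.1.smulRight p.2 :=
    (ContinuousLinearMap.smulRightL ℝ V E).continuous₂
  have : SecondCountableTopologyEither V (V →L[ℝ] ℝ) := secondCountableTopologyEither_of_left _ _
  have h2 : Continuous fun l : V => (innerSL ℝ l : V →L[ℝ] ℝ) := (innerSL ℝ).continuous
  have h3 : AEStronglyMeasurable (fun l => (innerSL ℝ l, Complex.I • g l)) μ :=
    h2.aestronglyMeasurable.prodMk (hg.const_smul Complex.I)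
  exact (h1.comp_aestronglyMeasurable h3 :)

theorem integrable_derivSymbol {μ : Measure V} {g : V → E} (hg : AEStronglyMeasurable g μ)
    (hg' : Integrable (fun l => ‖l‖ * ‖g l‖) μ) : Integrable (derivSymbol g) μ :=
  hg'.mono' (aestronglyMeasurable_derivSymbol hg)
    (.of_forall fun l => (norm_derivSymbol g l).le)

theorem hasFDerivAt_fourierInt [IsScalarTower ℝ ℂ E] {μ : Measure V} {g : V → E} (hg : Integrable g μ)
    (hg' : Integrable (fun l => ‖l‖ * ‖g l‖) μ) (x : V) :
    HasFDerivAt (fourierInt μ g) (fourierInt μ (derivSymbol g) x) x := by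
  refine hasFDerivAt_integral_of_dominated_of_fderiv_le (bound := fun l => ‖l‖ * ‖g l‖)
    Filter.univ_mem (.of_forall (aestronglyMeasurable_cexp_smul hg.1))
    (integrable_cexp_smul hg x)
    (aestronglyMeasurable_cexp_smul (aestronglyMeasurable_derivSymbol hg.1) x)
    (.of_forall fun l y _ => ?_) hg'
    (.of_forall fun l y _ => hasFDerivAt_cexp_I_mul_inner_smul g l y)
  rw [norm_smul, norm_cexp_I_mul_inner, one_mul, norm_derivSymbol]

theorem contDiff_two_fourierInt [IsScalarTower ℝ ℂ E] {μ : Measure V} {g : V → E}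
    (hg : Integrable g μ) (hg₁ : Integrable (fun l => ‖l‖ * ‖g l‖) μ)
    (hg₂ : Integrable (fun l => ‖l‖ * ‖derivSymbol g l‖) μ) :
    ContDiff ℝ 2 (fourierInt μ g) := by
  have hd := integrable_derivSymbol hg.1 hg₁
  have h1 : ContDiff ℝ 1 (fourierInt μ (derivSymbol g)) :=
    contDiff_one_iff_hasFDerivAt.2 ⟨_, continuous_fourierInt (integrable_derivSymbol hd.1 hg₂),
      hasFDerivAt_fourierInt hd hg₂⟩
  exact (contDiff_succ_iff_hasFDerivAt (n := 1)).2 ⟨_, h1, hasFDerivAt_fourierInt hg hg₁⟩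

theorem exists_norm_iteratedFDeriv_fourierInt_le [IsScalarTower ℝ ℂ E] {μ : Measure V} {g : V → E}
    (hg : Integrable g μ) (hg₁ : Integrable (fun l => ‖l‖ * ‖g l‖) μ)
    (hg₂ : Integrable (fun l => ‖l‖ * ‖derivSymbol g l‖) μ) (i : ℕ) (hi : i ≤ 2) :
    ∃ M, ∀ x, ‖iteratedFDeriv ℝ i (fourierInt μ g) x‖ ≤ M := by
  have hd := integrable_derivSymbol hg.1 hg₁
  have e1 : fderiv ℝ (fourierInt μ g) = fourierInt μ (derivSymbol g) :=
    funext fun x => (hasFDerivAt_fourierInt hg hg₁ x).fderiv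
  have e2 : fderiv ℝ (fourierInt μ (derivSymbol g)) =
      fourierInt μ (derivSymbol (derivSymbol g)) :=
    funext fun x => (hasFDerivAt_fourierInt hd hg₂ x).fderiv
  interval_cases i
  · exact ⟨_, fun x => norm_iteratedFDeriv_zero.trans_le (norm_fourierInt_le μ _ x)⟩
  · refine ⟨∫ l, ‖derivSymbol g l‖ ∂μ, fun x => ?_⟩
    rw [← norm_iteratedFDeriv_fderiv, e1, norm_iteratedFDeriv_zero]
    exact norm_fourierInt_le μ _ x
  · refine ⟨∫ l, ‖derivSymbol (derivSymbol g) l‖ ∂μ, fun x => ?_⟩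
    rw [← norm_iteratedFDeriv_fderiv, e1, ← norm_iteratedFDeriv_fderiv, e2,
      norm_iteratedFDeriv_zero]
    exact norm_fourierInt_le μ _ x

end FourierIntegral

theorem lap2_fourierInt {μ : Measure Plane} {g : Plane → ℂ} (hg : Integrable g μ)
    (hg₁ : Integrable (fun l => ‖l‖ * ‖g l‖) μ)
    (hg₂ : Integrable (fun l => ‖l‖ * ‖derivSymbol g l‖) μ) (x : Plane) :
    lap2 (fourierInt μ g) x = fourierInt μ (fun l => -(Complex.ofReal (‖l‖ ^ 2)) * g l) x := by
  have hd := integrable_derivSymbol hg.1 hg₁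
  have hdd := integrable_derivSymbol hd.1 hg₂
  have key (v : Plane) : fderiv ℝ (fun y => fderiv ℝ (fourierInt μ g) y v) x v =
      ∫ l, (Complex.exp (Complex.I * Complex.ofReal ⟪l, x⟫) •
        derivSymbol (derivSymbol g) l) v v ∂μ := by
    have h1 : (fun y => fderiv ℝ (fourierInt μ g) y v) =
        fun y => fourierInt μ (derivSymbol g) y v :=
      funext fun y => by rw [(hasFDerivAt_fourierInt hg hg₁ y).fderiv]
    have h2 := (hasFDerivAt_fourierInt hd hg₂ x).clm_apply (hasFDerivAt_const v x)
    have h3 := integrable_cexp_smul hdd x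
    rw [h1, h2.fderiv]
    simp only [ContinuousLinearMap.comp_zero, zero_add, ContinuousLinearMap.flip_apply, fourierInt]
    rw [ContinuousLinearMap.integral_apply h3, ContinuousLinearMap.integral_apply]
    exact h3.apply_continuousLinearMap v
  have hi (v : Plane) : Integrable (fun l => (Complex.exp (Complex.I * Complex.ofReal ⟪l, x⟫) •
        derivSymbol (derivSymbol g) l) v v) μ :=
    ((integrable_cexp_smul hdd x).apply_continuousLinearMap v).apply_continuousLinearMap v
  simp only [lap2, key]
  rw [← integral_finsetSum _ fun i _ => hi _]
  refine integral_congr_ae (.of_forall fun l => ?_)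
  simp only [derivSymbol, EuclideanSpace.real_norm_sq_eq, Fin.sum_univ_two,
    smul_apply, ContinuousLinearMap.smulRight_apply, innerSL_apply_apply,
    EuclideanSpace.inner_single_right, smul_eq_mul, Complex.real_smul]
  simp
  linear_combination (Complex.exp (Complex.I * Complex.ofReal ⟪l, x⟫)) * g l *
    ((l 0 : ℂ) ^ 2 + (l 1 : ℂ) ^ 2) * Complex.I_sq

/-- For a finite Borel charge `ν = h·μ` with `ν({0}) = 0` and `∫ ‖λ‖⁻² d|ν| < ∞`, the
background `b̃` is continuous and bounded, and `φ̃` is a `C²` solution of the Poisson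
equation `Δφ̃ = b̃`, bounded together with all its derivatives up to order two. -/
theorem poisson_solution_of_fourier_charge (μ : Measure Plane) [IsFiniteMeasure μ]
    (hμ0 : μ {0} = 0) (h : Plane → ℂ) (hmeas : Measurable h) (hb : ∀ l, ‖h l‖ ≤ 1)
    (hint : ∫⁻ l, ENNReal.ofReal (‖l‖ ^ (-2 : ℝ)) ∂μ < ⊤) :
    Continuous (bTilde μ h) ∧ (∃ M, ∀ x, ‖bTilde μ h x‖ ≤ M) ∧
      ContDiff ℝ 2 (phiTilde μ h) ∧
      (∀ i : ℕ, i ≤ 2 → ∃ M, ∀ x, ‖iteratedFDeriv ℝ i (phiTilde μ h) x‖ ≤ M) ∧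
      ∀ x, lap2 (phiTilde μ h) x = bTilde μ h x := by
  have hne : ∀ᵐ l ∂μ, l ≠ 0 := by
    rw [ae_iff]; simpa using hμ0
  have hh : Integrable h μ :=
    (integrable_const (1 : ℝ)).mono' hmeas.aestronglyMeasurable (.of_forall hb)
  have hbT : bTilde μ h = fourierInt μ h := rfl
  set g : Plane → ℂ := fun l => -(Complex.ofReal (‖l‖ ^ (-2 : ℝ)) * h l) with hgdef
  have hphi : phiTilde μ h = fourierInt μ g := by
    funext x
    rw [phiTilde, fourierInt, ← integral_neg]
    refine integral_congr_ae (.of_forall fun l => ?_)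
    simp only [hgdef, smul_eq_mul]
    ring
  have hw : Integrable (fun l : Plane => ‖l‖ ^ (-2 : ℝ)) μ := by
    refine ⟨(measurable_norm.pow_const _).aestronglyMeasurable, ?_⟩
    rw [hasFiniteIntegral_iff_ofReal (.of_forall fun l => by positivity)]
    exact hint
  have hgm : Measurable g := by fun_prop
  have hgn (l : Plane) : ‖g l‖ ≤ ‖l‖ ^ (-2 : ℝ) := by
    have h0 : 0 ≤ ‖l‖ ^ (-2 : ℝ) := by positivity
    rw [hgdef]
    simp only [norm_neg, norm_mul, Complex.norm_real, Real.norm_of_nonneg h0]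
    exact mul_le_of_le_one_right h0 (hb l)
  have hg : Integrable g μ := hw.mono' hgm.aestronglyMeasurable (.of_forall hgn)
  have hsq {l : Plane} (hl : l ≠ 0) : ‖l‖ ^ 2 * ‖l‖ ^ (-2 : ℝ) = 1 := by
    have : ‖l‖ ≠ 0 := norm_ne_zero_iff.2 hl
    rw [Real.rpow_neg (norm_nonneg l), Real.rpow_two]
    field_simp
  have hg2 : Integrable (fun l => ‖l‖ * ‖derivSymbol g l‖) μ := by
    simp only [norm_derivSymbol]
    refine (integrable_const (1 : ℝ)).mono' (by fun_prop) ?_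
    filter_upwards [hne] with l hl
    rw [Real.norm_of_nonneg (by positivity), ← hsq hl, ← mul_assoc, ← sq]
    gcongr
    exact hgn l
  have hg1 : Integrable (fun l => ‖l‖ * ‖g l‖) μ := by
    refine (hg.norm.add hg2).mono' (by fun_prop) (.of_forall fun l => ?_)
    simp only [norm_derivSymbol, Pi.add_apply]
    rw [Real.norm_of_nonneg (by positivity)]
    nlinarith [mul_nonneg (norm_nonneg (g l)) (sq_nonneg (‖l‖ - 1)), norm_nonneg (g l),
      mul_nonneg (norm_nonneg (g l)) (sq_nonneg (‖l‖))]
  rw [hbT, hphi]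
  refine ⟨continuous_fourierInt hh, ⟨_, norm_fourierInt_le μ h⟩,
    contDiff_two_fourierInt hg hg1 hg2,
    exists_norm_iteratedFDeriv_fourierInt_le hg hg1 hg2, fun x => ?_⟩
  rw [lap2_fourierInt hg hg1 hg2]
  refine integral_congr_ae ?_
  filter_upwards [hne] with l hl
  have := congrArg Complex.ofReal (hsq hl)
  rw [Complex.ofReal_mul, Complex.ofReal_one] at this
  simp only [hgdef]
  congr 1
  linear_combination h l * this
end

section
/- Let μ be a finite Borel measure on ℝ² with μ({0}) = 0 and let h : ℝ² → ℂ be measurable with |h(λ)| ≤ 1. Define φ̃(x) := ∫_{ℝ²} (⟨λ, x⟩² / ‖λ‖²) · (∫₀¹ (1 − s) exp(i s ⟨λ, x⟩) ds) · h(λ) dμ(λ). Then φ̃ is twice continuously differentiable, Δφ̃(x) = ∫_{ℝ²} exp(i⟨λ, x⟩) h(λ) dμ(λ) for every x ∈ ℝ², and φ̃(x) = o(‖x‖²) as ‖x‖ → ∞, i.e. φ̃(x)/‖x‖² → 0. (This is the claim in the Remark after Proposition 2.1: without assuming ∫‖λ‖⁻² d|ν| < ∞, the Poisson equation Δφ̃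 = b̃ still has a C² solution growing slower than ‖x‖².) -/
open MeasureTheory Filter
open scoped RealInnerProductSpace Topology

/-- The solution
`φ̃(x) = ∫_{ℝ²} (⟨λ,x⟩²/‖λ‖²) ∫₀¹ (1−s) e^{isλ·x} ds dν(λ)` of the Poisson equation. -/
noncomputable def phiTilde' (μ : Measure Plane) (h : Plane → ℂ) (x : Plane) : ℂ :=
  ∫ l, Complex.ofReal (⟪l, x⟫ ^ 2 / ‖l‖ ^ 2) *
    (∫ s in (0 : ℝ)..1, (1 - Complex.ofReal s) *
      Complex.exp (Complex.I * Complex.ofReal s * Complex.ofReal ⟪l, x⟫)) * h l ∂μ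

/-- The function `t ↦ 1 + i t - e^{it}`, which equals `t² ∫₀¹ (1 - s) e^{ist} ds`. -/
noncomputable def expRemainder (t : ℝ) : ℂ :=
  1 + Complex.I * t - Complex.exp (Complex.I * t)

lemma sq_mul_integral_eq_expRemainder (t : ℝ) :
    (t : ℂ) ^ 2 * (∫ s in (0 : ℝ)..1, (1 - Complex.ofReal s) *
      Complex.exp (Complex.I * Complex.ofReal s * Complex.ofReal t)) = expRemainder t := by
  rw [← intervalIntegral.integral_const_mul]
  have hderiv : ∀ s : ℝ, HasDerivAt (fun s : ℝ =>
      -Complex.I * t * ((1 - s) * Complex.exp (Complex.I * s * t))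
        - Complex.exp (Complex.I * s * t))
      ((t : ℂ) ^ 2 * ((1 - s) * Complex.exp (Complex.I * s * t))) s := by
    intro s
    have hid : HasDerivAt (fun s : ℝ => (s : ℂ)) 1 s := Complex.ofRealCLM.hasDerivAt
    have hexp := ((hid.const_mul Complex.I).mul_const (t : ℂ)).cexp
    refine ((((hid.const_sub 1).mul hexp).const_mul (-Complex.I * t)).sub hexp).congr_deriv ?_
    linear_combination (-(t : ℂ) ^ 2 * (1 - s) * Complex.exp (Complex.I * s * t)) * Complex.I_sq
  rw [intervalIntegral.integral_eq_sub_of_hasDerivAt (fun s _ => hderiv s)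
    (by apply Continuous.intervalIntegrable; fun_prop)]
  simp [expRemainder]
  ring

lemma norm_expRemainder_le_sq (t : ℝ) : ‖expRemainder t‖ ≤ t ^ 2 := by
  rw [← sq_mul_integral_eq_expRemainder, norm_mul]
  have hint : ‖∫ s in (0 : ℝ)..1, (1 - Complex.ofReal s) *
      Complex.exp (Complex.I * Complex.ofReal s * Complex.ofReal t)‖ ≤ 1 * |(1 : ℝ) - 0| := by
    apply intervalIntegral.norm_integral_le_of_norm_le_const
    intro s hs
    rw [Set.uIoc_of_le zero_le_one] at hs
    have hexp : ‖Complex.exp (Complex.I * s * t)‖ = 1 := by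
      rw [mul_assoc, ← Complex.ofReal_mul, Complex.norm_exp_I_mul_ofReal]
    rw [norm_mul, hexp, ← Complex.ofReal_one, ← Complex.ofReal_sub, Complex.norm_real,
      Real.norm_eq_abs, abs_of_nonneg] <;> linarith [hs.1, hs.2]
  simp only [norm_pow, Complex.norm_real, Real.norm_eq_abs, sq_abs]
  norm_num at hint
  exact mul_le_of_le_one_right (sq_nonneg t) hint

lemma norm_expRemainder_le (t : ℝ) : ‖expRemainder t‖ ≤ 2 + |t| := by
  calc ‖expRemainder t‖ ≤ ‖(1 : ℂ) + Complex.I * t‖ + ‖Complex.exp (Complex.I * t)‖ :=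
        norm_sub_le _ _
    _ ≤ ‖(1 : ℂ)‖ + ‖Complex.I * t‖ + ‖Complex.exp (Complex.I * t)‖ := by
        gcongr; exact norm_add_le _ _
    _ = 2 + |t| := by
        rw [Complex.norm_exp_I_mul_ofReal]; simp; ring

lemma hasDerivAt_expRemainder (t : ℝ) :
    HasDerivAt expRemainder (Complex.I * (1 - Complex.exp (Complex.I * t))) t := by
  have hid : HasDerivAt (fun s : ℝ => (s : ℂ)) 1 t := Complex.ofRealCLM.hasDerivAt
  have hlin := hid.const_mul Complex.I
  refine ((hlin.const_add 1).sub hlin.cexp).congr_deriv ?_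
  ring

lemma hasDerivAt_deriv_expRemainder (t : ℝ) :
    HasDerivAt (fun t : ℝ => Complex.I * (1 - Complex.exp (Complex.I * t)))
      (Complex.exp (Complex.I * t)) t := by
  have hid : HasDerivAt (fun s : ℝ => (s : ℂ)) 1 t := Complex.ofRealCLM.hasDerivAt
  refine (((hid.const_mul Complex.I).cexp.const_sub 1).const_mul Complex.I).congr_deriv ?_
  linear_combination -Complex.exp (Complex.I * t) * Complex.I_sq

lemma norm_deriv_expRemainder_le (t : ℝ) :
    ‖Complex.I * (1 - Complex.exp (Complex.I * t))‖ ≤ |t| := by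
  rw [norm_mul, Complex.norm_I, one_mul, norm_sub_rev]
  exact Real.norm_exp_I_mul_ofReal_sub_one_le

/-- Differentiation under the integral sign for superpositions of plane waves `F ⟪l, x⟫`. -/
lemma hasFDerivAt_integral_inner {E V : Type*} [NormedAddCommGroup E] [InnerProductSpace ℝ E]
    [MeasurableSpace E] [BorelSpace E] [SecondCountableTopology E]
    [NormedAddCommGroup V] [NormedSpace ℝ V] [NormedSpace ℂ V] [IsScalarTower ℝ ℂ V]
    [CompleteSpace V] (μ : Measure E) [IsFiniteMeasure μ] {F F' : ℝ → ℂ} {w : E → V}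
    (hF : ∀ t, HasDerivAt F (F' t) t) (hF' : Continuous F') (hw : AEStronglyMeasurable w μ)
    (a : E) (hint : Integrable (fun l => F ⟪l, a⟫ • w l) μ) {C : ℝ}
    (hC : ∀ l, ∀ x ∈ Metric.ball a 1, ‖F' ⟪l, x⟫‖ * (‖l‖ * ‖w l‖) ≤ C) :
    HasFDerivAt (fun x => ∫ l, F ⟪l, x⟫ • w l ∂μ)
      (∫ l, F' ⟪l, a⟫ • (innerSL ℝ l).smulRight (w l) ∂μ) a := by
  have hFc : Continuous F := continuous_iff_continuousAt.2 fun t => (hF t).continuousAt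
  have hwave : ∀ {G : ℝ → ℂ}, Continuous G → ∀ x : E,
      AEStronglyMeasurable (fun l : E => G ⟪l, x⟫) μ := fun hG x =>
    (hG.comp (continuous_id.inner continuous_const)).aestronglyMeasurable
  have : SecondCountableTopologyEither E (E →L[ℝ] ℝ) := ⟨Or.inl inferInstance⟩
  have hW : AEStronglyMeasurable (fun l => (innerSL ℝ l).smulRight (w l)) μ :=
    (ContinuousLinearMap.smulRightL ℝ E V).continuous₂.comp_aestronglyMeasurable
      ((innerSL ℝ (E := E)).continuous.aestronglyMeasurable.prodMk hw)
  refine hasFDerivAt_integral_of_dominated_of_fderiv_le (bound := fun _ => C)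
    (F' := fun x l => F' ⟪l, x⟫ • (innerSL ℝ l).smulRight (w l))
    (Metric.ball_mem_nhds a one_pos) (Eventually.of_forall fun x => (hwave hFc x).smul hw) hint
    ((hwave hF' a).smul hW)
    (Eventually.of_forall fun l x hx => ?_) (integrable_const C)
    (Eventually.of_forall fun l x _ => ?_)
  · rw [norm_smul, ContinuousLinearMap.norm_smulRight_apply, innerSL_apply_norm]
    exact hC l x hx
  · have hinner : HasFDerivAt (fun x : E => ⟪l, x⟫) (innerSL ℝ l) x := (innerSL ℝ l).hasFDerivAt
    have hcomp := ((hF ⟪l, x⟫).hasFDerivAt.comp x hinner).smul_const (w l)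
    refine hcomp.congr_fderiv ?_
    ext v
    have hv := IsScalarTower.algebraMap_smul ℂ ⟪l, v⟫ (w l)
    rw [Complex.coe_algebraMap] at hv
    simp [mul_comm _ (F' _), mul_smul, hv]

/-- The weight `h(l) / ‖l‖²` against which `phiTilde'` superposes plane waves. -/
noncomputable def invSqWeight (h : Plane → ℂ) (l : Plane) : ℂ := (‖l‖ ^ 2)⁻¹ • h l

lemma aestronglyMeasurable_invSqWeight (μ : Measure Plane) {h : Plane → ℂ} (hmeas : Measurable h) :
    AEStronglyMeasurable (invSqWeight h) μ :=
  ((measurable_norm.pow_const 2).inv.smul hmeas).aestronglyMeasurable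

lemma norm_sq_mul_norm_invSqWeight_le {h : Plane → ℂ} (hbd : ∀ l, ‖h l‖ ≤ 1) (l : Plane) :
    ‖l‖ ^ 2 * ‖invSqWeight h l‖ ≤ 1 := by
  rw [invSqWeight, norm_smul, Real.norm_of_nonneg (by positivity), ← mul_assoc]
  exact mul_le_one₀ mul_inv_le_one (norm_nonneg _) (hbd l)

lemma phiTilde'_eq_integral_expRemainder (μ : Measure Plane) (h : Plane → ℂ) :
    phiTilde' μ h = fun x => ∫ l, expRemainder ⟪l, x⟫ • invSqWeight h l ∂μ := by
  funext x
  refine integral_congr_ae (Eventually.of_forall fun l => ?_)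
  simp only [← sq_mul_integral_eq_expRemainder, invSqWeight, Complex.real_smul, smul_eq_mul]
  push_cast
  ring

lemma norm_expRemainder_smul_le {h : Plane → ℂ} (hbd : ∀ l, ‖h l‖ ≤ 1) (l x : Plane) :
    ‖expRemainder ⟪l, x⟫ • invSqWeight h l‖ ≤ ‖x‖ ^ 2 := by
  have hw := norm_sq_mul_norm_invSqWeight_le hbd l
  have hin : ⟪l, x⟫ ^ 2 ≤ (‖l‖ * ‖x‖) ^ 2 := sq_le_sq' (by
    linarith [neg_abs_le ⟪l, x⟫, abs_real_inner_le_norm l x]) (real_inner_le_norm l x)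
  calc ‖expRemainder ⟪l, x⟫ • invSqWeight h l‖
      ≤ (‖l‖ * ‖x‖) ^ 2 * ‖invSqWeight h l‖ := by
        rw [norm_smul]; gcongr; exact (norm_expRemainder_le_sq _).trans hin
    _ = ‖x‖ ^ 2 * (‖l‖ ^ 2 * ‖invSqWeight h l‖) := by ring
    _ ≤ ‖x‖ ^ 2 := mul_le_of_le_one_right (by positivity) hw

lemma norm_deriv_expRemainder_mul_le {h : Plane → ℂ} (hbd : ∀ l, ‖h l‖ ≤ 1) (l x : Plane) :
    ‖Complex.I * (1 - Complex.exp (Complex.I * ⟪l, x⟫))‖ * (‖l‖ * ‖invSqWeight h l‖) ≤ ‖x‖ := by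
  have hw := norm_sq_mul_norm_invSqWeight_le hbd l
  calc _ ≤ (‖l‖ * ‖x‖) * (‖l‖ * ‖invSqWeight h l‖) := by
        gcongr
        exact (norm_deriv_expRemainder_le _).trans (abs_real_inner_le_norm l x)
    _ = ‖x‖ * (‖l‖ ^ 2 * ‖invSqWeight h l‖) := by ring
    _ ≤ ‖x‖ := mul_le_of_le_one_right (norm_nonneg x) hw

lemma aestronglyMeasurable_comp_inner_smul {V : Type*} [NormedAddCommGroup V] [NormedSpace ℂ V]
    (μ : Measure Plane) {F : ℝ → ℂ} (hF : Continuous F) {w : Plane → V}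
    (hw : AEStronglyMeasurable w μ) (x : Plane) :
    AEStronglyMeasurable (fun l => F ⟪l, x⟫ • w l) μ :=
  (hF.comp (continuous_id.inner continuous_const)).aestronglyMeasurable.smul hw

lemma aestronglyMeasurable_innerSL_smulRight {V : Type*} [NormedAddCommGroup V] [NormedSpace ℝ V]
    (μ : Measure Plane) {w : Plane → V} (hw : AEStronglyMeasurable w μ) :
    AEStronglyMeasurable (fun l => (innerSL ℝ l).smulRight (w l)) μ :=
  (ContinuousLinearMap.smulRightL ℝ Plane V).continuous₂.comp_aestronglyMeasurable
    ((innerSL ℝ (E := Plane)).continuous.aestronglyMeasurable.prodMk hw)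

lemma hasFDerivAt_phiTilde' (μ : Measure Plane) [IsFiniteMeasure μ]
    {h : Plane → ℂ} (hmeas : Measurable h) (hbd : ∀ l, ‖h l‖ ≤ 1) (x : Plane) :
    HasFDerivAt (phiTilde' μ h)
      (∫ l, (Complex.I * (1 - Complex.exp (Complex.I * ⟪l, x⟫))) •
        (innerSL ℝ l).smulRight (invSqWeight h l) ∂μ) x := by
  have hw := aestronglyMeasurable_invSqWeight μ hmeas
  have hc : Continuous expRemainder :=
    continuous_iff_continuousAt.2 fun t => (hasDerivAt_expRemainder t).continuousAt
  rw [phiTilde'_eq_integral_expRemainder]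
  refine hasFDerivAt_integral_inner μ hasDerivAt_expRemainder (by fun_prop) hw x
    (Integrable.of_bound (aestronglyMeasurable_comp_inner_smul μ hc hw x) (‖x‖ ^ 2)
      (Eventually.of_forall fun l => norm_expRemainder_smul_le hbd l x)) (C := ‖x‖ + 1) ?_
  intro l y hy
  refine (norm_deriv_expRemainder_mul_le hbd l y).trans ?_
  have := norm_le_norm_add_norm_sub' y x
  rw [mem_ball_iff_norm] at hy
  linarith

set_option maxSynthPendingDepth 3 in
lemma norm_exp_smul_smulRight_le {h : Plane → ℂ} (hbd : ∀ l, ‖h l‖ ≤ 1) (l x : Plane) :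
    ‖Complex.exp (Complex.I * ⟪l, x⟫) • (innerSL ℝ l).smulRight
      ((innerSL ℝ l).smulRight (invSqWeight h l))‖ ≤ 1 := by
  rw [norm_smul, Complex.norm_exp_I_mul_ofReal, one_mul,
    ContinuousLinearMap.norm_smulRight_apply, ContinuousLinearMap.norm_smulRight_apply,
    innerSL_apply_norm, ← mul_assoc, ← sq]
  exact norm_sq_mul_norm_invSqWeight_le hbd l

set_option maxSynthPendingDepth 3 in
lemma hasFDerivAt_fderiv_phiTilde' (μ : Measure Plane) [IsFiniteMeasure μ]
    {h : Plane → ℂ} (hmeas : Measurable h) (hbd : ∀ l, ‖h l‖ ≤ 1) (x : Plane) :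
    HasFDerivAt (fderiv ℝ (phiTilde' μ h))
      (∫ l, Complex.exp (Complex.I * ⟪l, x⟫) • (innerSL ℝ l).smulRight
        ((innerSL ℝ l).smulRight (invSqWeight h l)) ∂μ) x := by
  have hW := aestronglyMeasurable_innerSL_smulRight μ (aestronglyMeasurable_invSqWeight μ hmeas)
  rw [funext fun y => (hasFDerivAt_phiTilde' μ hmeas hbd y).fderiv]
  refine hasFDerivAt_integral_inner μ hasDerivAt_deriv_expRemainder (by fun_prop) hW x
    (Integrable.of_bound (aestronglyMeasurable_comp_inner_smul μ
      (F := fun t => Complex.I * (1 - Complex.exp (Complex.I * t))) (by fun_prop) hW x) ‖x‖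
      (Eventually.of_forall fun l => ?_)) (C := 1) ?_
  · rw [norm_smul, ContinuousLinearMap.norm_smulRight_apply, innerSL_apply_norm]
    exact norm_deriv_expRemainder_mul_le hbd l x
  · intro l y _
    have := norm_exp_smul_smulRight_le hbd l y
    rwa [norm_smul, ContinuousLinearMap.norm_smulRight_apply, innerSL_apply_norm] at this

lemma aestronglyMeasurable_exp_smul_smulRight (μ : Measure Plane)
    {h : Plane → ℂ} (hmeas : Measurable h) (x : Plane) :
    AEStronglyMeasurable (fun l => Complex.exp (Complex.I * ⟪l, x⟫) • (innerSL ℝ l).smulRight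
      ((innerSL ℝ l).smulRight (invSqWeight h l))) μ :=
  aestronglyMeasurable_comp_inner_smul μ (F := fun t => Complex.exp (Complex.I * t))
    (by fun_prop) (aestronglyMeasurable_innerSL_smulRight μ
      (aestronglyMeasurable_innerSL_smulRight μ (aestronglyMeasurable_invSqWeight μ hmeas))) x

lemma contDiff_two_phiTilde' (μ : Measure Plane) [IsFiniteMeasure μ]
    {h : Plane → ℂ} (hmeas : Measurable h) (hbd : ∀ l, ‖h l‖ ≤ 1) :
    ContDiff ℝ 2 (phiTilde' μ h) := by
  refine contDiff_succ_iff_hasFDerivAt (n := 1).2 ⟨fderiv ℝ (phiTilde' μ h), ?_, fun x =>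
    (hasFDerivAt_phiTilde' μ hmeas hbd x).differentiableAt.hasFDerivAt⟩
  refine contDiff_one_iff_hasFDerivAt.2 ⟨_, ?_, hasFDerivAt_fderiv_phiTilde' μ hmeas hbd⟩
  exact continuous_of_dominated (aestronglyMeasurable_exp_smul_smulRight μ hmeas)
    (fun x => Eventually.of_forall fun l => norm_exp_smul_smulRight_le hbd l x)
    (integrable_const 1) (Eventually.of_forall fun l => by fun_prop)

set_option maxSynthPendingDepth 3 in
lemma lap2_phiTilde' (μ : Measure Plane) [IsFiniteMeasure μ] (hμ0 : μ {0} = 0)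
    {h : Plane → ℂ} (hmeas : Measurable h) (hbd : ∀ l, ‖h l‖ ≤ 1) (x : Plane) :
    lap2 (phiTilde' μ h) x = ∫ l, Complex.exp (Complex.I * ⟪l, x⟫) * h l ∂μ := by
  have hint : Integrable (fun l => Complex.exp (Complex.I * ⟪l, x⟫) • (innerSL ℝ l).smulRight
      ((innerSL ℝ l).smulRight (invSqWeight h l))) μ :=
    Integrable.of_bound (aestronglyMeasurable_exp_smul_smulRight μ hmeas x) 1
      (Eventually.of_forall fun l => norm_exp_smul_smulRight_le hbd l x)
  have hpartial : ∀ v : Plane, fderiv ℝ (fun y => fderiv ℝ (phiTilde' μ h) y v) x v =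
      ∫ l, (Complex.exp (Complex.I * ⟪l, x⟫) • (innerSL ℝ l).smulRight
        ((innerSL ℝ l).smulRight (invSqWeight h l))) v v ∂μ := by
    intro v
    have hd := (hasFDerivAt_fderiv_phiTilde' μ hmeas hbd x).clm_apply (hasFDerivAt_const v x)
    rw [hd.fderiv]
    simp only [add_apply, ContinuousLinearMap.comp_apply,
      zero_apply, map_zero, zero_add, ContinuousLinearMap.flip_apply]
    rw [ContinuousLinearMap.integral_apply hint,
      ContinuousLinearMap.integral_apply (hint.apply_continuousLinearMap v)]
  have hint' : ∀ v : Plane, Integrable (fun l => (Complex.exp (Complex.I * ⟪l, x⟫) •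
      (innerSL ℝ l).smulRight ((innerSL ℝ l).smulRight (invSqWeight h l))) v v) μ := fun v =>
    (hint.apply_continuousLinearMap v).apply_continuousLinearMap v
  simp only [lap2, hpartial]
  rw [← integral_finsetSum _ fun i _ => hint' _]
  have hne : ∀ᵐ l ∂μ, l ≠ 0 := by simpa [ae_iff] using hμ0
  refine integral_congr_ae (hne.mono fun l hl => ?_)
  have hl2 : ((l 0 : ℂ) ^ 2 + (l 1 : ℂ) ^ 2) ≠ 0 := by
    have : ‖l‖ ^ 2 ≠ 0 := by simpa using hl
    rw [EuclideanSpace.real_norm_sq_eq, Fin.sum_univ_two] at this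
    exact_mod_cast this
  simp [Fin.sum_univ_two, invSqWeight, EuclideanSpace.real_norm_sq_eq,
    EuclideanSpace.inner_single_right]
  field_simp

lemma tendsto_phiTilde'_div_norm_sq (μ : Measure Plane) [IsFiniteMeasure μ]
    {h : Plane → ℂ} (hmeas : Measurable h) (hbd : ∀ l, ‖h l‖ ≤ 1) :
    Tendsto (fun x : Plane => phiTilde' μ h x / (Complex.ofReal (‖x‖ ^ 2)))
      (Filter.comap (fun x : Plane => ‖x‖) atTop) (𝓝 0) := by
  have hw := aestronglyMeasurable_invSqWeight μ hmeas
  have hc : Continuous expRemainder :=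
    continuous_iff_continuousAt.2 fun t => (hasDerivAt_expRemainder t).continuousAt
  have hnorm : Tendsto (fun x : Plane => ‖x‖) (comap (fun x : Plane => ‖x‖) atTop) atTop :=
    tendsto_comap
  have hlim : Tendsto (fun x : Plane => ∫ l, (expRemainder ⟪l, x⟫ • invSqWeight h l) /
      (Complex.ofReal (‖x‖ ^ 2)) ∂μ) (comap (fun x : Plane => ‖x‖) atTop)
      (𝓝 (∫ _, (0 : ℂ) ∂μ)) := by
    refine tendsto_integral_filter_of_dominated_convergence (fun _ => 1)
      (Eventually.of_forall fun x => ?_) (Eventually.of_forall fun x =>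
        Eventually.of_forall fun l => ?_) (integrable_const 1)
      (Eventually.of_forall fun l => ?_)
    · simp only [div_eq_mul_inv]
      exact (aestronglyMeasurable_comp_inner_smul μ hc hw x).mul_const _
    · rw [norm_div, Complex.norm_real, Real.norm_of_nonneg (by positivity)]
      exact div_le_one_of_le₀ (norm_expRemainder_smul_le hbd l x) (by positivity)
    · have hz : Tendsto (fun r : ℝ => (2 * r⁻¹ ^ 2 + ‖l‖ * r⁻¹) * ‖invSqWeight h l‖) atTop
          (𝓝 ((2 * 0 ^ 2 + ‖l‖ * 0) * ‖invSqWeight h l‖)) :=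
        (((tendsto_inv_atTop_zero.pow 2).const_mul 2).add
          (tendsto_inv_atTop_zero.const_mul ‖l‖)).mul_const _
      simp only [ne_eq, OfNat.ofNat_ne_zero, not_false_eq_true, zero_pow, mul_zero, add_zero,
        zero_mul] at hz
      refine squeeze_zero_norm' ?_ (hz.comp hnorm)
      filter_upwards [hnorm.eventually_gt_atTop 0] with x hx
      rw [norm_div, Complex.norm_real, Real.norm_of_nonneg (by positivity), norm_smul,
        div_le_iff₀ (by positivity)]
      calc ‖expRemainder ⟪l, x⟫‖ * ‖invSqWeight h l‖
          ≤ (2 + ‖l‖ * ‖x‖) * ‖invSqWeight h l‖ := by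
            gcongr
            exact (norm_expRemainder_le _).trans (by gcongr; exact abs_real_inner_le_norm l x)
        _ = _ := by simp only [Function.comp_apply]; field_simp
  simpa only [phiTilde'_eq_integral_expRemainder, integral_div, integral_zero] using hlim

/-- Without assuming `∫ ‖λ‖⁻² d|ν| < ∞`, the Poisson equation `Δφ̃ = b̃` still has a
`C²` solution `φ̃` with `φ̃(x) = o(‖x‖²)` as `‖x‖ → ∞`. -/
theorem poisson_solution_subquadratic (μ : Measure Plane) [IsFiniteMeasure μ]
    (hμ0 : μ {0} = 0) (h : Plane → ℂ) (hmeas : Measurable h) (hbd : ∀ l, ‖h l‖ ≤ 1) :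
    ContDiff ℝ 2 (phiTilde' μ h) ∧
    (∀ x : Plane, lap2 (phiTilde' μ h) x =
      ∫ l, Complex.exp (Complex.I * Complex.ofReal ⟪l, x⟫) * h l ∂μ) ∧
    Tendsto (fun x : Plane => phiTilde' μ h x / (Complex.ofReal (‖x‖ ^ 2)))
      (Filter.comap (fun x : Plane => ‖x‖) atTop) (𝓝 0) := by
  exact ⟨contDiff_two_phiTilde' μ hmeas hbd, lap2_phiTilde' μ hμ0 hmeas hbd,
    tendsto_phiTilde'_div_norm_sq μ hmeas hbd⟩
end

section
/- Let m > 3. For E > 0 define K_E : ℝ × ℝ → ℝ by K_E(x, y) = (1 + x²)^{−m/4} · (1 − exp(−√E |x − y|)) / (2√E) · (1 + y²)^{−m/4}, and K₀(x, y) = (1 + x²)^{−m/4} · (|x − y| / 2) · (1 + y²)^{−m/4}. Then ∫_ℝ ∫_ℝ K₀(x, y)² dx dy < ∞, for every E > 0 ∫_ℝ ∫_ℝ (K_E(x, y) − K₀(x, y))² dx dy < ∞, and lim_{E→0⁺} ∫_ℝ ∫_ℝ (K_E(x, y) − K₀(x, y))² dx dy = 0. (This is the Hilbert–Schmidt convergence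 ‖J̃_{m}(E) − J̃_{m}(0)‖₂ → 0, the key analytic step in the proof of Proposition 5.2.) -/
open MeasureTheory Filter
open scoped Topology

/-- The kernel `K_E(x,y) = ⟨x⟩^{−m/2} (1−e^{−√E|x−y|})/(2√E) ⟨y⟩^{−m/2}` for `E > 0`. -/
noncomputable def kerE (m E x y : ℝ) : ℝ :=
  (1 + x ^ 2) ^ (-m / 4) * ((1 - Real.exp (-Real.sqrt E * |x - y|)) / (2 * Real.sqrt E)) *
    (1 + y ^ 2) ^ (-m / 4)

/-- The limiting kernel `K₀(x,y) = ⟨x⟩^{−m/2} (|x−y|/2) ⟨y⟩^{−m/2}`. -/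
noncomputable def kerZero (m x y : ℝ) : ℝ :=
  (1 + x ^ 2) ^ (-m / 4) * (|x - y| / 2) * (1 + y ^ 2) ^ (-m / 4)

lemma measurable_kerZero (m : ℝ) : Measurable fun p : ℝ × ℝ => kerZero m p.1 p.2 := by
  unfold kerZero
  fun_prop

lemma measurable_kerE (m E : ℝ) : Measurable fun p : ℝ × ℝ => kerE m E p.1 p.2 := by
  unfold kerE
  fun_prop

lemma sq_rpow_weight_mul (m x : ℝ) :
    ((1 + x ^ 2) ^ (-m / 4)) ^ 2 * (1 + x ^ 2) = (1 + x ^ 2) ^ (-(m - 2) / 2) := by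
  have hx : 0 < 1 + x ^ 2 := by positivity
  rw [← Real.rpow_natCast, ← Real.rpow_mul hx.le, ← Real.rpow_add_one hx.ne']
  congr 1
  push_cast
  ring

lemma sq_kerZero_le (m x y : ℝ) :
    (kerZero m x y) ^ 2 ≤ (1 + x ^ 2) ^ (-(m - 2) / 2) * (1 + y ^ 2) ^ (-(m - 2) / 2) := by
  rw [← sq_rpow_weight_mul, ← sq_rpow_weight_mul]
  unfold kerZero
  set a := (1 + x ^ 2) ^ (-m / 4)
  set b := (1 + y ^ 2) ^ (-m / 4)
  have hxy : (|x - y| / 2) ^ 2 ≤ (1 + x ^ 2) * (1 + y ^ 2) := by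
    rw [div_pow, sq_abs]
    nlinarith [sq_nonneg (1 + x * y), sq_nonneg (x - y)]
  calc (a * (|x - y| / 2) * b) ^ 2 = (a * b) ^ 2 * (|x - y| / 2) ^ 2 := by ring
    _ ≤ (a * b) ^ 2 * ((1 + x ^ 2) * (1 + y ^ 2)) := by gcongr
    _ = a ^ 2 * (1 + x ^ 2) * (b ^ 2 * (1 + y ^ 2)) := by ring

lemma integrable_sq_kerZero {m : ℝ} (hm : 3 < m) :
    Integrable fun p : ℝ × ℝ => (kerZero m p.1 p.2) ^ 2 := by
  have h : Integrable fun x : ℝ => (1 + x ^ 2) ^ (-(m - 2) / 2) := by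
    have := integrable_rpow_neg_one_add_norm_sq (E := ℝ) (μ := volume) (r := m - 2)
      (by rw [Module.finrank_self]; push_cast; linarith)
    simpa using this
  refine (h.mul_prod h).mono' ((measurable_kerZero m).pow_const 2).aestronglyMeasurable ?_
  refine ae_of_all _ fun p => ?_
  rw [Real.norm_of_nonneg (sq_nonneg _)]
  exact sq_kerZero_le m p.1 p.2

lemma one_sub_exp_div_mem_Icc {s t : ℝ} (hs : 0 < s) (ht : 0 ≤ t) :
    (1 - Real.exp (-s * t)) / (2 * s) ∈ Set.Icc 0 (t / 2) := by
  constructor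
  · have : Real.exp (-s * t) ≤ 1 := Real.exp_le_one_iff.2 (by nlinarith)
    exact div_nonneg (by linarith) (by positivity)
  · rw [div_le_div_iff₀ (by positivity) two_pos]
    nlinarith [Real.add_one_le_exp (-s * t)]

lemma sq_kerE_sub_kerZero_le (m : ℝ) {E : ℝ} (hE : 0 < E) (x y : ℝ) :
    (kerE m E x y - kerZero m x y) ^ 2 ≤ (kerZero m x y) ^ 2 := by
  obtain ⟨h₀, h₁⟩ := one_sub_exp_div_mem_Icc (Real.sqrt_pos.2 hE) (abs_nonneg (x - y))
  have ha : 0 ≤ (1 + x ^ 2) ^ (-m / 4) := by positivity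
  have hb : 0 ≤ (1 + y ^ 2) ^ (-m / 4) := by positivity
  have hnonneg : 0 ≤ kerE m E x y := mul_nonneg (mul_nonneg ha h₀) hb
  have hle : kerE m E x y ≤ kerZero m x y := by
    unfold kerE kerZero
    gcongr
  nlinarith

lemma integrable_sq_kerE_sub_kerZero {m : ℝ} (hm : 3 < m) {E : ℝ} (hE : 0 < E) :
    Integrable fun p : ℝ × ℝ => (kerE m E p.1 p.2 - kerZero m p.1 p.2) ^ 2 := by
  refine (integrable_sq_kerZero hm).mono'
    (((measurable_kerE m E).sub (measurable_kerZero m)).pow_const 2).aestronglyMeasurable ?_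
  refine ae_of_all _ fun p => ?_
  rw [Real.norm_of_nonneg (sq_nonneg _)]
  exact sq_kerE_sub_kerZero_le m hE p.1 p.2

lemma tendsto_one_sub_exp_div (t : ℝ) :
    Tendsto (fun s : ℝ => (1 - Real.exp (-s * t)) / (2 * s)) (𝓝[>] 0) (𝓝 (t / 2)) := by
  have h : HasDerivAt (fun s : ℝ => (1 - Real.exp (-s * t)) / 2) (t / 2) 0 := by
    have := ((((hasDerivAt_id (0 : ℝ)).neg.mul_const t).exp).const_sub 1).div_const 2
    simpa using this
  refine h.tendsto_slope_zero_right.congr fun s => ?_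
  simp only [zero_add, neg_zero, zero_mul, Real.exp_zero, sub_self, zero_div, sub_zero,
    smul_eq_mul]
  rw [inv_mul_eq_div, div_div]

lemma tendsto_kerE (m x y : ℝ) :
    Tendsto (fun E : ℝ => kerE m E x y) (𝓝[>] 0) (𝓝 (kerZero m x y)) := by
  have hsqrt : Tendsto Real.sqrt (𝓝[>] 0) (𝓝[>] 0) := by
    refine tendsto_nhdsWithin_iff.2 ⟨?_, ?_⟩
    · simpa using (Real.continuous_sqrt.tendsto 0).mono_left nhdsWithin_le_nhds
    · filter_upwards [self_mem_nhdsWithin] with E hE using Real.sqrt_pos.2 hE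
  exact (((tendsto_one_sub_exp_div |x - y|).comp hsqrt).const_mul _).mul_const _

/-- For `m > 3`: `K₀` is square integrable, `K_E − K₀` is square integrable for every
`E > 0`, and `∬ (K_E − K₀)² → 0` as `E ↓ 0` (Hilbert–Schmidt convergence
`‖J̃_m(E) − J̃_m(0)‖₂ → 0`). -/
theorem kernel_hs_convergence (m : ℝ) (hm : 3 < m) :
    Integrable (fun p : ℝ × ℝ => (kerZero m p.1 p.2) ^ 2) ∧
    (∀ E : ℝ, 0 < E →
      Integrable (fun p : ℝ × ℝ => (kerE m E p.1 p.2 - kerZero m p.1 p.2) ^ 2)) ∧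
    Tendsto (fun E : ℝ => ∫ p : ℝ × ℝ, (kerE m E p.1 p.2 - kerZero m p.1 p.2) ^ 2)
      (𝓝[>] 0) (𝓝 0) := by
  refine ⟨integrable_sq_kerZero hm, fun E hE => integrable_sq_kerE_sub_kerZero hm hE, ?_⟩
  have key : Tendsto (fun E : ℝ => ∫ p : ℝ × ℝ, (kerE m E p.1 p.2 - kerZero m p.1 p.2) ^ 2)
      (𝓝[>] 0) (𝓝 (∫ _ : ℝ × ℝ, (0 : ℝ))) := by
    refine tendsto_integral_filter_of_dominated_convergence
      (fun p : ℝ × ℝ => (kerZero m p.1 p.2) ^ 2) ?_ ?_ (integrable_sq_kerZero hm) ?_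
    · filter_upwards [self_mem_nhdsWithin] with E hE
      exact (integrable_sq_kerE_sub_kerZero hm hE).aestronglyMeasurable
    · filter_upwards [self_mem_nhdsWithin] with E hE
      refine ae_of_all _ fun p => ?_
      rw [Real.norm_of_nonneg (sq_nonneg _)]
      exact sq_kerE_sub_kerZero_le m hE p.1 p.2
    · refine ae_of_all _ fun p => ?_
      simpa using ((tendsto_kerE m p.1 p.2).sub_const (kerZero m p.1 p.2)).pow 2
  simpa using key
end

section
/- Let a > 0 and let f : ℝ → ℂ be continuous with compact support. Define u(x) := ∫_ℝ (exp(−a|x − y|) / (2a)) f(y) dy. Then u is twice continuously differentiable and −u''(x) + a² u(x) = f(x) for every x ∈ ℝ. (With a = √(−E) for E < 0, this verifies that the operator with integral kernel ℛ_E(x − y) = e^{−√(−E)|x−y|}/(2√(−E)) is the resolvent (−d²/dx² − E)⁻¹ on the real axis below the spectrum.) -/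
open MeasureTheory

theorem hasDerivAt_integral_Iic {g : ℝ → ℂ} (hg : Continuous g) (hi : Integrable g) (x : ℝ) :
    HasDerivAt (fun t => ∫ y in Set.Iic t, g y) (g x) x := by
  have h := (intervalIntegral.integral_hasDerivAt_right (hg.intervalIntegrable 0 x)
    (hg.stronglyMeasurableAtFilter _ _) hg.continuousAt).const_add (∫ y in Set.Iic 0, g y)
  refine h.congr_of_eventuallyEq (Filter.Eventually.of_forall fun t => ?_)
  have := intervalIntegral.integral_Iic_sub_Iic (hi.integrableOn (s := Set.Iic 0))
    (hi.integrableOn (s := Set.Iic t))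
  simp [← this]

theorem hasDerivAt_integral_Ioi {g : ℝ → ℂ} (hg : Continuous g) (hi : Integrable g) (x : ℝ) :
    HasDerivAt (fun t => ∫ y in Set.Ioi t, g y) (-g x) x := by
  refine ((hasDerivAt_integral_Iic hg hi x).const_sub (∫ y, g y)).congr_of_eventuallyEq
    (Filter.Eventually.of_forall fun t => ?_)
  have := intervalIntegral.integral_Iic_add_Ioi (hi.integrableOn (s := Set.Iic t))
    (hi.integrableOn (s := Set.Ioi t))
  simp [← this]

theorem hasDerivAt_ofReal_exp_mul (c x : ℝ) :
    HasDerivAt (fun t : ℝ => (Real.exp (c * t) : ℂ)) (c * Real.exp (c * x)) x := by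
  have h := (((hasDerivAt_id x).const_mul c).exp).ofReal_comp
  refine h.congr_deriv ?_
  simp only [id, mul_one]
  push_cast
  ring

theorem ofReal_exp_neg_mul_mul_exp_mul (c x : ℝ) :
    (Real.exp (-c * x) : ℂ) * Real.exp (c * x) = 1 := by
  rw [← Complex.ofReal_mul, ← Real.exp_add]
  simp

section ExpWeight

variable {f : ℝ → ℂ}

theorem continuous_exp_mul_mul (c : ℝ) (hf : Continuous f) :
    Continuous fun y : ℝ => (Real.exp (c * y) : ℂ) * f y := by
  fun_prop

theorem integrable_exp_mul_mul (c : ℝ) (hf : Continuous f) (hsupp : HasCompactSupport f) :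
    Integrable fun y : ℝ => (Real.exp (c * y) : ℂ) * f y :=
  (continuous_exp_mul_mul c hf).integrable_of_hasCompactSupport hsupp.mul_left

theorem hasDerivAt_exp_mul_integral_Iic (c : ℝ) (hf : Continuous f) (hsupp : HasCompactSupport f)
    (x : ℝ) :
    HasDerivAt (fun t : ℝ => (Real.exp (-c * t) : ℂ) *
        ∫ y in Set.Iic t, (Real.exp (c * y) : ℂ) * f y)
      (-c * ((Real.exp (-c * x) : ℂ) * ∫ y in Set.Iic x, (Real.exp (c * y) : ℂ) * f y) + f x)
      x := by
  refine ((hasDerivAt_ofReal_exp_mul (-c) x).mul (hasDerivAt_integral_Iic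
    (continuous_exp_mul_mul c hf) (integrable_exp_mul_mul c hf hsupp) x)).congr_deriv ?_
  rw [← mul_assoc (Real.exp (-c * x) : ℂ) _ (f x), ofReal_exp_neg_mul_mul_exp_mul]
  push_cast
  ring

theorem hasDerivAt_exp_mul_integral_Ioi (c : ℝ) (hf : Continuous f) (hsupp : HasCompactSupport f)
    (x : ℝ) :
    HasDerivAt (fun t : ℝ => (Real.exp (c * t) : ℂ) *
        ∫ y in Set.Ioi t, (Real.exp (-c * y) : ℂ) * f y)
      (c * ((Real.exp (c * x) : ℂ) * ∫ y in Set.Ioi x, (Real.exp (-c * y) : ℂ) * f y) - f x)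
      x := by
  refine ((hasDerivAt_ofReal_exp_mul c x).mul (hasDerivAt_integral_Ioi
    (continuous_exp_mul_mul (-c) hf) (integrable_exp_mul_mul (-c) hf hsupp) x)).congr_deriv ?_
  rw [mul_neg, ← mul_assoc (Real.exp (c * x) : ℂ) _ (f x), mul_comm (Real.exp (c * x) : ℂ)
    (Real.exp (-c * x) : ℂ), ofReal_exp_neg_mul_mul_exp_mul]
  ring

theorem integral_exp_neg_mul_abs_sub (a : ℝ) (hf : Continuous f) (hsupp : HasCompactSupport f)
    (x : ℝ) :
    ∫ y : ℝ, (Real.exp (-a * |x - y|) / (2 * a) : ℂ) * f y =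
      ((Real.exp (-a * x) : ℂ) * (∫ y in Set.Iic x, (Real.exp (a * y) : ℂ) * f y) +
        (Real.exp (a * x) : ℂ) * ∫ y in Set.Ioi x, (Real.exp (-a * y) : ℂ) * f y) / (2 * a) := by
  have hi : Integrable fun y : ℝ => (Real.exp (-a * |x - y|) / (2 * a) : ℂ) * f y :=
    Continuous.integrable_of_hasCompactSupport (by fun_prop) hsupp.mul_left
  rw [← intervalIntegral.integral_Iic_add_Ioi (hi.integrableOn (s := Set.Iic x))
    (hi.integrableOn (s := Set.Ioi x)), add_div, mul_div_right_comm, mul_div_right_comm,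
    ← integral_const_mul, ← integral_const_mul]
  congr 1
  · refine setIntegral_congr_fun measurableSet_Iic fun y hy => ?_
    have : -a * |x - y| = -a * x + a * y := by
      rw [abs_of_nonneg (sub_nonneg.2 hy)]; ring
    simp only [this, Real.exp_add, Complex.ofReal_mul]
    ring
  · refine setIntegral_congr_fun measurableSet_Ioi fun y hy => ?_
    have : -a * |x - y| = a * x + -a * y := by
      rw [abs_of_nonpos (sub_nonpos.2 (le_of_lt hy))]; ring
    simp only [this, Real.exp_add, Complex.ofReal_mul]
    ring

end ExpWeight

/-- For `a > 0` and continuous compactly supported `f`, the function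
`u(x) = ∫_ℝ e^{−a|x−y|}/(2a) f(y) dy` is `C²` and satisfies `−u'' + a² u = f`:
the kernel `e^{−√(−E)|x−y|}/(2√(−E))` is the resolvent `(−d²/dx² − E)⁻¹` for `E < 0`. -/
theorem resolvent_kernel_negative_energy (a : ℝ) (ha : 0 < a) (f : ℝ → ℂ)
    (hf : Continuous f) (hsupp : HasCompactSupport f) :
    ContDiff ℝ 2 (fun x : ℝ => ∫ y : ℝ, (Real.exp (-a * |x - y|) / (2 * a) : ℂ) * f y) ∧
    ∀ x : ℝ,
      -(deriv (deriv (fun x : ℝ => ∫ y : ℝ, (Real.exp (-a * |x - y|) / (2 * a) : ℂ) * f y)) x) +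
        (a : ℂ) ^ 2 * ∫ y : ℝ, (Real.exp (-a * |x - y|) / (2 * a) : ℂ) * f y = f x := by
  have ha' : (a : ℂ) ≠ 0 := by exact_mod_cast ha.ne'
  simp only [integral_exp_neg_mul_abs_sub a hf hsupp]
  have hP := hasDerivAt_exp_mul_integral_Iic a hf hsupp
  have hQ := hasDerivAt_exp_mul_integral_Ioi a hf hsupp
  set P : ℝ → ℂ := fun t => (Real.exp (-a * t) : ℂ) *
    ∫ y in Set.Iic t, (Real.exp (a * y) : ℂ) * f y
  set Q : ℝ → ℂ := fun t => (Real.exp (a * t) : ℂ) *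
    ∫ y in Set.Ioi t, (Real.exp (-a * y) : ℂ) * f y
  change ∀ x, HasDerivAt P (-a * P x + f x) x at hP
  change ∀ x, HasDerivAt Q (a * Q x - f x) x at hQ
  change ContDiff ℝ 2 (fun x => (P x + Q x) / (2 * a)) ∧
    ∀ x, -deriv (deriv fun x => (P x + Q x) / (2 * a)) x +
      (a : ℂ) ^ 2 * ((P x + Q x) / (2 * a)) = f x
  have hu (x : ℝ) : HasDerivAt (fun x => (P x + Q x) / (2 * a)) ((Q x - P x) / 2) x := by
    refine (((hP x).add (hQ x)).div_const (2 * (a : ℂ))).congr_deriv ?_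
    field_simp
    ring
  have hu' (x : ℝ) : HasDerivAt (fun x => (Q x - P x) / 2) (a * (P x + Q x) / 2 - f x) x := by
    refine (((hQ x).sub (hP x)).div_const 2).congr_deriv ?_
    ring
  have hPc : Continuous P := continuous_iff_continuousAt.2 fun x => (hP x).continuousAt
  have hQc : Continuous Q := continuous_iff_continuousAt.2 fun x => (hQ x).continuousAt
  have hd : (deriv fun x => (P x + Q x) / (2 * a)) = fun x => (Q x - P x) / 2 :=
    deriv_eq hu
  have hd' : (deriv fun x => (Q x - P x) / 2) = fun x => a * (P x + Q x) / 2 - f x :=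
    deriv_eq hu'
  refine ⟨?_, fun x => ?_⟩
  · rw [← one_add_one_eq_two, contDiff_succ_iff_deriv]
    refine ⟨fun x => (hu x).differentiableAt, by simp, ?_⟩
    rw [hd, contDiff_one_iff_deriv, hd']
    exact ⟨fun x => (hu' x).differentiableAt, by fun_prop⟩
  · rw [hd, hd']
    field_simp
    ring
end
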